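/- The number of off-diagonally symmetric alternating sign matrices of order 2n+1 equals (2^{n-1} (3n+2)!/(2n+1)!) · ∏_{i=1}^{n} (6i-2)!/(2n+2i+1)!. -/

import Mathlib

open Finset

/-- An alternating sign matrix: entries in {-1,0,1}, all row/column prefix sums in {0,1}
(equivalent to the nonzero entries alternating in sign starting and ending with 1),
and all row and column sums equal to 1. -/
def IsASM {n : ℕ} (A : Matrix (Fin n) (Fin n) ℤ) : Prop :=
  (∀ i j, A i j = -1 ∨ A i j = 0 ∨ A i j = 1) ∧
  (∀ i k : Fin n, (∑ j ∈ Finset.univ.filter (fun j => j ≤ k), A i j) = 0 ∨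
                  (∑ j ∈ Finset.univ.filter (fun j => j ≤ k), A i j) = 1) ∧
  (∀ j k : Fin n, (∑ i ∈ Finset.univ.filter (fun i => i ≤ k), A i j) = 0 ∨
                  (∑ i ∈ Finset.univ.filter (fun i => i ≤ k), A i j) = 1) ∧
  (∀ i, ∑ j, A i j = 1) ∧
  (∀ j, ∑ i, A i j = 1)

/-- A diagonally symmetric ASM. -/
def IsDSASM {n : ℕ} (A : Matrix (Fin n) (Fin n) ℤ) : Prop :=
  IsASM A ∧ A.IsSymm

/-- An even-order off-diagonally symmetric ASM: a DSASM with all diagonal entries zero. -/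
def IsOSASMeven {n : ℕ} (A : Matrix (Fin n) (Fin n) ℤ) : Prop :=
  IsDSASM A ∧ ∀ i, A i i = 0

/-- An odd-order off-diagonally symmetric ASM: a DSASM with exactly one nonzero diagonal entry. -/
def IsOSASModd {n : ℕ} (A : Matrix (Fin n) (Fin n) ℤ) : Prop :=
  IsDSASM A ∧ (Finset.univ.filter (fun i => A i i ≠ 0)).card = 1

/-- R(A): the number of nonzero entries strictly above the diagonal. -/
def Rstat {n : ℕ} (A : Matrix (Fin n) (Fin n) ℤ) : ℕ :=
  ∑ p ∈ Finset.univ.filter (fun p : Fin n × Fin n => p.1 < p.2), (A p.1 p.2).natAbs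

/-- S(A): the number of nonzero diagonal entries. -/
def Sstat {n : ℕ} (A : Matrix (Fin n) (Fin n) ℤ) : ℕ :=
  ∑ i, (A i i).natAbs

/-- T(A): the (1-based) column index of the unique 1 in the first row
(for an ASM, the first row has a single nonzero entry, which equals 1). -/
def Tstat {n : ℕ} (A : Matrix (Fin n) (Fin n) ℤ) : ℕ :=
  ∑ p ∈ Finset.univ.filter (fun p : Fin n × Fin n => p.1.1 = 0),
    (p.2.1 + 1) * (A p.1 p.2).natAbs

/-- Weight of a zero entry whose two incoming states agree. -/
noncomputable def weightA (ρ u : ℂ) : ℂ := ((2 - ρ) * u + (1 + ρ)) / 3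

/-- Weight of a zero entry whose two incoming states differ. -/
noncomputable def weightB (ρ u : ℂ) : ℂ := ((2 - ρ) + (1 + ρ) * u) / 3

/-- Weight of a nonzero diagonal entry reached in state `v`. -/
noncomputable def weightF (ρ : ℂ) (v : Bool) (x : ℂ) : ℂ :=
  (ρ - 1) * (if v then 1 else x) / (ρ * x - 1)

/-- Sum over the fillings of a row with parameter `x`, crossing columns with parameters `ys` and
incoming states `vs`, starting in state `h` and ending in state `true`; the outgoing column states
are weighted by `Ψ`. -/
noncomputable def rowSum (ρ x : ℂ) : List ℂ → Bool → List Bool → (List Bool → ℂ) → ℂ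
  | [], h, _, Ψ => if h then Ψ [] else 0
  | _ :: _, _, [], _ => 0
  | y :: ys, h, v :: vs, Ψ =>
    if h = v then
      weightA ρ (x * y) * rowSum ρ x ys h vs (fun t => Ψ (v :: t)) +
        (if h then 1 else x * y) * rowSum ρ x ys (!h) vs (fun t => Ψ ((!v) :: t))
    else weightB ρ (x * y) * rowSum ρ x ys h vs (fun t => Ψ (v :: t))

/-- Partition function of the triangle with line parameters `xs` and incoming states `vs`,
with zero diagonal. -/
noncomputable def evenSum (ρ : ℂ) : List ℂ → List Bool → ℂ
  | [], _ => 1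
  | _ :: _, [] => 0
  | x :: xs, v :: vs => rowSum ρ x xs v vs (evenSum ρ xs)

/-- Partition function of the triangle with line parameters `xs` and incoming states `vs`,
with exactly one nonzero diagonal entry. -/
noncomputable def oddSum (ρ : ℂ) : List ℂ → List Bool → ℂ
  | [], _ => 0
  | _ :: _, [] => 0
  | x :: xs, v :: vs => rowSum ρ x xs v vs (oddSum ρ xs) +
      weightF ρ v x * rowSum ρ x xs (!v) vs (evenSum ρ xs)

section row

variable (ρ x y : ℂ) (ys : List ℂ) (h : Bool) (vs : List Bool) (Ψ Φ : List Bool → ℂ)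

@[simp] lemma rowSum_nil : rowSum ρ x [] h vs Ψ = if h then Ψ [] else 0 := by
  simp [rowSum]

@[simp] lemma rowSum_cons_nil : rowSum ρ x (y :: ys) h [] Ψ = 0 := by
  simp [rowSum]

@[simp] lemma rowSum_false_false : rowSum ρ x (y :: ys) false (false :: vs) Ψ =
    weightA ρ (x * y) * rowSum ρ x ys false vs (fun t => Ψ (false :: t)) +
      x * y * rowSum ρ x ys true vs (fun t => Ψ (true :: t)) := by
  simp [rowSum]

@[simp] lemma rowSum_true_true : rowSum ρ x (y :: ys) true (true :: vs) Ψ =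
    weightA ρ (x * y) * rowSum ρ x ys true vs (fun t => Ψ (true :: t)) +
      rowSum ρ x ys false vs (fun t => Ψ (false :: t)) := by
  simp [rowSum]

@[simp] lemma rowSum_false_true : rowSum ρ x (y :: ys) false (true :: vs) Ψ =
    weightB ρ (x * y) * rowSum ρ x ys false vs (fun t => Ψ (true :: t)) := by
  simp [rowSum]

@[simp] lemma rowSum_true_false : rowSum ρ x (y :: ys) true (false :: vs) Ψ =
    weightB ρ (x * y) * rowSum ρ x ys true vs (fun t => Ψ (false :: t)) := by
  simp [rowSum]

lemma rowSum_add : rowSum ρ x ys h vs (fun t => Ψ t + Φ t) =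
    rowSum ρ x ys h vs Ψ + rowSum ρ x ys h vs Φ := by
  induction ys generalizing h vs Ψ Φ with
  | nil => cases h <;> simp
  | cons y ys ih =>
    rcases vs with _ | ⟨v, vs⟩
    · simp
    · cases h <;> cases v <;> simp [ih] <;> ring

lemma rowSum_smul (c : ℂ) : rowSum ρ x ys h vs (fun t => c * Ψ t) =
    c * rowSum ρ x ys h vs Ψ := by
  induction ys generalizing h vs Ψ with
  | nil => cases h <;> simp
  | cons y ys ih =>
    rcases vs with _ | ⟨v, vs⟩
    · simp
    · cases h <;> cases v <;> simp [ih] <;> ring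

variable {ys Ψ Φ} in
lemma rowSum_congr (H : ∀ t : List Bool, t.length = ys.length → Ψ t = Φ t) :
    rowSum ρ x ys h vs Ψ = rowSum ρ x ys h vs Φ := by
  induction ys generalizing h vs Ψ Φ with
  | nil => simp [H []]
  | cons y ys ih =>
    rcases vs with _ | ⟨v, vs⟩
    · simp
    · have := fun (b k : Bool) => ih k vs (Ψ := fun t => Ψ (b :: t)) (Φ := fun t => Φ (b :: t))
        (fun t ht => H _ (by simp [ht]))
      cases h <;> cases v <;> simp [this]

end row

/-- The exchange relation between two functions of a pair of states. -/
def Exchange (ρ x y : ℂ) (φ φ' : Bool → Bool → ℂ) : Prop :=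
  ((ρ * x - (1 - ρ) * y) * φ' false false = (ρ * x - (1 - ρ) * y) * φ false false ∧
  (ρ * x - (1 - ρ) * y) * φ' true true = (ρ * x - (1 - ρ) * y) * φ true true) ∧
  (ρ * x - (1 - ρ) * y) * φ' false true =
    (2 * ρ - 1) * y * φ false true + (x - y) * φ true false ∧
  (ρ * x - (1 - ρ) * y) * φ' true false =
    (2 * ρ - 1) * x * φ true false + (x - y) * φ false true

/-- The exchange relation at positions `k` and `k + 1` of a list of states. -/
def ExchangeAt (ρ x y : ℂ) : ℕ → (List Bool → ℂ) → (List Bool → ℂ) → Prop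
  | 0, Φ, Φ' => ∀ w, Exchange ρ x y (fun a b => Φ (a :: b :: w)) (fun a b => Φ' (a :: b :: w))
  | k + 1, Φ, Φ' => ∀ v, ExchangeAt ρ x y k (fun t => Φ (v :: t)) (fun t => Φ' (v :: t))

lemma ExchangeAt.add {ρ x y : ℂ} {k : ℕ} {Φ Φ' Ψ Ψ' : List Bool → ℂ}
    (h : ExchangeAt ρ x y k Φ Φ') (h' : ExchangeAt ρ x y k Ψ Ψ') :
    ExchangeAt ρ x y k (fun t => Φ t + Ψ t) (fun t => Φ' t + Ψ' t) := by
  induction k generalizing Φ Φ' Ψ Ψ' with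
  | zero =>
    intro w
    obtain ⟨⟨a, b⟩, c, d⟩ := h w
    obtain ⟨⟨a', b'⟩, c', d'⟩ := h' w
    refine ⟨⟨?_, ?_⟩, ?_, ?_⟩
    · linear_combination a + a'
    · linear_combination b + b'
    · linear_combination c + c'
    · linear_combination d + d'
  | succ k ih => exact fun v => ih (h v) (h' v)

lemma ExchangeAt.smul {ρ x y : ℂ} {k : ℕ} {Φ Φ' : List Bool → ℂ} (r : ℂ)
    (h : ExchangeAt ρ x y k Φ Φ') :
    ExchangeAt ρ x y k (fun t => r * Φ t) (fun t => r * Φ' t) := by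
  induction k generalizing Φ Φ' with
  | zero =>
    intro w
    obtain ⟨⟨a, b⟩, c, d⟩ := h w
    refine ⟨⟨?_, ?_⟩, ?_, ?_⟩
    · linear_combination r * a
    · linear_combination r * b
    · linear_combination r * c
    · linear_combination r * d
  | succ k ih => exact fun v => ih (h v)

lemma ExchangeAt.apply {ρ x y : ℂ} {k : ℕ} {Φ Φ' : List Bool → ℂ}
    (h : ExchangeAt ρ x y k Φ Φ') (hA : ρ * x - (1 - ρ) * y ≠ 0) (w : List Bool) :
    Φ' (List.replicate k false ++ false :: false :: w) =
      Φ (List.replicate k false ++ false :: false :: w) := by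
  induction k generalizing Φ Φ' with
  | zero => exact mul_left_cancel₀ hA (h w).1.1
  | succ k ih => exact ih (h false)

section exchange

variable {ρ : ℂ} (hρ : ρ ^ 2 = ρ - 1) (x y z : ℂ)
include hρ

set_option linter.unusedSimpArgs false in
lemma rowSum_exchange_zero (post : List ℂ) (h : Bool) {Φ Φ' : List Bool → ℂ}
    (H : ExchangeAt ρ x y 0 Φ Φ') :
    ExchangeAt ρ x y 0 (fun vs => rowSum ρ z (x :: y :: post) h vs Φ)
      (fun vs => rowSum ρ z (y :: x :: post) h vs Φ') := by
  intro w
  have key : ∀ k, Exchange ρ x y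
      (fun a b => rowSum ρ z post k w (fun t => Φ (a :: b :: t)))
      (fun a b => rowSum ρ z post k w (fun t => Φ' (a :: b :: t))) := by
    intro k
    refine ⟨⟨?_, ?_⟩, ?_, ?_⟩ <;> simp only [← rowSum_smul, ← rowSum_add]
    · exact rowSum_congr _ _ _ _ fun t _ => (H t).1.1
    · exact rowSum_congr _ _ _ _ fun t _ => (H t).1.2
    · exact rowSum_congr _ _ _ _ fun t _ => (H t).2.1
    · exact rowSum_congr _ _ _ _ fun t _ => (H t).2.2
  obtain ⟨⟨a, b⟩, c, d⟩ := key false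
  obtain ⟨⟨a', b'⟩, c', d'⟩ := key true
  have h3 : ρ ^ 3 = -1 := by linear_combination (ρ + 1) * hρ
  have h4 : ρ ^ 4 = -ρ := by linear_combination ρ * h3
  cases h
  · refine ⟨⟨?_, ?_⟩, ?_, ?_⟩ <;>
      simp only [rowSum_false_false, rowSum_false_true, rowSum_true_true, rowSum_true_false]
    · linear_combination (norm := (
          simp only [weightA, weightB]
          ring_nf
          simp only [hρ, h3, h4]
          ring))
        weightA ρ (z * y) * weightA ρ (z * x) * a + weightA ρ (z * y) * (z * x) * c' +
        z * y * weightB ρ (z * x) * d'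
    · linear_combination weightB ρ (z * y) * weightB ρ (z * x) * b
    · linear_combination (norm := (
          simp only [weightA, weightB]
          ring_nf
          simp only [hρ, h3, h4]
          ring))
        weightA ρ (z * y) * weightB ρ (z * x) * c + z * y * weightA ρ (z * x) * b' + z * y * d
    · linear_combination (norm := (
          simp only [weightA, weightB]
          ring_nf
          simp only [hρ, h3, h4]
          ring))
        weightB ρ (z * y) * weightA ρ (z * x) * d + weightB ρ (z * y) * (z * x) * b'
  · refine ⟨⟨?_, ?_⟩, ?_, ?_⟩ <;>
      simp only [rowSum_false_false, rowSum_false_true, rowSum_true_true, rowSum_true_false]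
    · linear_combination weightB ρ (z * y) * weightB ρ (z * x) * a'
    · linear_combination (norm := (
          simp only [weightA, weightB]
          ring_nf
          simp only [hρ, h3, h4]
          ring))
        weightA ρ (z * y) * weightA ρ (z * x) * b' + weightA ρ (z * y) * d + weightB ρ (z * x) * c
    · linear_combination (norm := (
          simp only [weightA, weightB]
          ring_nf
          simp only [hρ, h3, h4]
          ring))
        weightB ρ (z * y) * weightA ρ (z * x) * c' + weightB ρ (z * y) * a
    · linear_combination (norm := (
          simp only [weightA, weightB]
          ring_nf
          simp only [hρ, h3, h4]
          ring))
        weightA ρ (z * y) * weightB ρ (z * x) * d' + weightA ρ (z * x) * a + z * x * c'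

lemma rowSum_exchangeAt (pre post : List ℂ) (h : Bool) {Φ Φ' : List Bool → ℂ}
    (H : ExchangeAt ρ x y pre.length Φ Φ') :
    ExchangeAt ρ x y pre.length (fun vs => rowSum ρ z (pre ++ x :: y :: post) h vs Φ)
      (fun vs => rowSum ρ z (pre ++ y :: x :: post) h vs Φ') := by
  induction pre generalizing h Φ Φ' with
  | nil => exact rowSum_exchange_zero hρ x y z post h H
  | cons p pre ih =>
    intro v
    cases h <;> cases v <;>
      simp only [List.cons_append, rowSum_false_false, rowSum_false_true, rowSum_true_true,
        rowSum_true_false]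
    · exact ((ih false (H false)).smul _).add ((ih true (H true)).smul _)
    · exact (ih false (H true)).smul _
    · exact (ih true (H false)).smul _
    · exact ((ih true (H true)).smul _).add (ih false (H false))

set_option linter.unusedSimpArgs false in
lemma rowSum_rowSum_exchange (zs : List ℂ) (vs : List Bool) (Φ : List Bool → ℂ) :
    Exchange ρ x y (fun h k => rowSum ρ x zs h vs (fun t => rowSum ρ y zs k t Φ))
      (fun h k => rowSum ρ y zs h vs (fun t => rowSum ρ x zs k t Φ)) := by
  have h3 : ρ ^ 3 = -1 := by linear_combination (ρ + 1) * hρ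
  have h4 : ρ ^ 4 = -ρ := by linear_combination ρ * h3
  induction zs generalizing vs Φ with
  | nil => simp [Exchange]
  | cons z zs ih =>
    rcases vs with _ | ⟨v, vs⟩
    · simp [Exchange]
    obtain ⟨⟨a, b⟩, c, d⟩ := ih vs (fun t => Φ (false :: t))
    obtain ⟨⟨a', b'⟩, c', d'⟩ := ih vs (fun t => Φ (true :: t))
    cases v
    · refine ⟨⟨?_, ?_⟩, ?_, ?_⟩ <;> simp only [rowSum_false_false, rowSum_false_true, rowSum_true_true,
        rowSum_true_false, rowSum_add, rowSum_smul]
      · linear_combination (norm := (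
            simp only [weightA, weightB]
            ring_nf
            simp only [hρ, h3, h4]
            ring))
          weightA ρ (y * z) * weightA ρ (x * z) * a + weightA ρ (y * z) * (x * z) * c' +
          y * z * weightB ρ (x * z) * d'
      · linear_combination weightB ρ (y * z) * weightB ρ (x * z) * b
      · linear_combination (norm := (
            simp only [weightA, weightB]
            ring_nf
            simp only [hρ, h3, h4]
            ring))
          weightA ρ (y * z) * weightB ρ (x * z) * c + y * z * weightA ρ (x * z) * b' + y * z * d
      · linear_combination (norm := (
            simp only [weightA, weightB]
            ring_nf
            simp only [hρ, h3, h4]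
            ring))
          weightB ρ (y * z) * weightA ρ (x * z) * d + weightB ρ (y * z) * (x * z) * b'
    · refine ⟨⟨?_, ?_⟩, ?_, ?_⟩ <;> simp only [rowSum_false_false, rowSum_false_true, rowSum_true_true,
        rowSum_true_false, rowSum_add, rowSum_smul]
      · linear_combination weightB ρ (y * z) * weightB ρ (x * z) * a'
      · linear_combination (norm := (
            simp only [weightA, weightB]
            ring_nf
            simp only [hρ, h3, h4]
            ring))
          weightA ρ (y * z) * weightA ρ (x * z) * b' + weightA ρ (y * z) * d + weightB ρ (x * z) * c
      · linear_combination (norm := (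
            simp only [weightA, weightB]
            ring_nf
            simp only [hρ, h3, h4]
            ring))
          weightB ρ (y * z) * weightA ρ (x * z) * c' + weightB ρ (y * z) * a
      · linear_combination (norm := (
            simp only [weightA, weightB]
            ring_nf
            simp only [hρ, h3, h4]
            ring))
          weightA ρ (y * z) * weightB ρ (x * z) * d' + weightA ρ (x * z) * a + x * z * c'

set_option linter.unusedSimpArgs false in
lemma evenSum_exchange_zero (post : List ℂ) :
    ExchangeAt ρ x y 0 (evenSum ρ (x :: y :: post)) (evenSum ρ (y :: x :: post)) := by
  intro w
  obtain ⟨⟨a, b⟩, c, d⟩ := rowSum_rowSum_exchange hρ x y post w (evenSum ρ post)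
  refine ⟨⟨?_, ?_⟩, ?_, ?_⟩ <;> simp only [evenSum, rowSum_false_false, rowSum_false_true,
    rowSum_true_true, rowSum_true_false, mul_comm y x]
  · linear_combination weightA ρ (x * y) * a + x * y * b
  · linear_combination weightA ρ (x * y) * b + a
  · linear_combination weightB ρ (x * y) * c
  · linear_combination weightB ρ (x * y) * d

set_option linter.unusedSimpArgs false in
lemma oddSum_exchange_zero (hx : ρ * x - 1 ≠ 0) (hy : ρ * y - 1 ≠ 0) (post : List ℂ) :
    ExchangeAt ρ x y 0 (oddSum ρ (x :: y :: post)) (oddSum ρ (y :: x :: post)) := by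
  have h3 : ρ ^ 3 = -1 := by linear_combination (ρ + 1) * hρ
  have h4 : ρ ^ 4 = -ρ := by linear_combination ρ * h3
  intro w
  obtain ⟨⟨a, b⟩, c, d⟩ := rowSum_rowSum_exchange hρ x y post w (evenSum ρ post)
  obtain ⟨⟨a', b'⟩, c', d'⟩ := rowSum_rowSum_exchange hρ x y post w (oddSum ρ post)
  refine ⟨⟨?_, ?_⟩, ?_, ?_⟩ <;> simp only [oddSum, evenSum, rowSum_false_false, rowSum_false_true,
    rowSum_true_true, rowSum_true_false, mul_comm y x, Bool.not_false, Bool.not_true, rowSum_add,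
    rowSum_smul]
  · linear_combination (norm := (
        simp only [weightA, weightB, weightF, if_true, Bool.false_eq_true, if_false]
        field_simp
        ring_nf
        simp only [hρ, h3, h4]
        ring))
      weightA ρ (x * y) * a' + x * y * b' + weightA ρ (x * y) * weightF ρ false x * c +
      x * y * weightF ρ true x * d + weightF ρ false y * weightB ρ (x * y) * d
  · linear_combination (norm := (
        simp only [weightA, weightB, weightF, if_true, Bool.false_eq_true, if_false]
        field_simp
        ring_nf
        simp only [hρ, h3, h4]
        ring))
      weightA ρ (x * y) * b' + a' + weightA ρ (x * y) * weightF ρ true x * d +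
      weightF ρ false x * c + weightF ρ true y * weightB ρ (x * y) * c
  · linear_combination (norm := (
        simp only [weightA, weightB, weightF, if_true, Bool.false_eq_true, if_false]
        field_simp
        ring_nf
        simp only [hρ, h3, h4]
        ring))
      weightB ρ (x * y) * c' + weightB ρ (x * y) * weightF ρ true x * a +
      weightF ρ false y * weightA ρ (x * y) * b + weightF ρ false y * a
  · linear_combination (norm := (
        simp only [weightA, weightB, weightF, if_true, Bool.false_eq_true, if_false]
        field_simp
        ring_nf
        simp only [hρ, h3, h4]
        ring))
      weightB ρ (x * y) * d' + weightB ρ (x * y) * weightF ρ false x * b +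
      weightF ρ true y * weightA ρ (x * y) * a + weightF ρ true y * (x * y) * b

end exchange

section exchange

variable {ρ : ℂ} (hρ : ρ ^ 2 = ρ - 1) (x y : ℂ)
include hρ

lemma evenSum_exchangeAt (pre post : List ℂ) :
    ExchangeAt ρ x y pre.length (evenSum ρ (pre ++ x :: y :: post))
      (evenSum ρ (pre ++ y :: x :: post)) := by
  induction pre with
  | nil => exact evenSum_exchange_zero hρ x y post
  | cons p pre ih => exact fun v => rowSum_exchangeAt hρ x y p pre post v ih

lemma oddSum_exchangeAt (hx : ρ * x - 1 ≠ 0) (hy : ρ * y - 1 ≠ 0) (pre post : List ℂ) :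
    ExchangeAt ρ x y pre.length (oddSum ρ (pre ++ x :: y :: post))
      (oddSum ρ (pre ++ y :: x :: post)) := by
  induction pre with
  | nil => exact oddSum_exchange_zero hρ x y hx hy post
  | cons p pre ih =>
    exact fun v => (rowSum_exchangeAt hρ x y p pre post v ih).add
      ((rowSum_exchangeAt hρ x y p pre post (!v) (evenSum_exchangeAt hρ x y pre post)).smul _)

end exchange

/-- The partition function with zero diagonal and all incoming states `false`. -/
noncomputable def evenZ (ρ : ℂ) (xs : List ℂ) : ℂ :=
  evenSum ρ xs (List.replicate xs.length false)

/-- The partition function with one nonzero diagonal entry and all incoming states `false`. -/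
noncomputable def oddZ (ρ : ℂ) (xs : List ℂ) : ℂ :=
  oddSum ρ xs (List.replicate xs.length false)

section root

variable {ρ : ℂ} (hρ : ρ ^ 2 = ρ - 1)
include hρ

lemma root_im_ne_zero : ρ.im ≠ 0 := by
  intro h
  have h1 := congrArg Complex.re hρ
  simp [pow_two, h] at h1
  nlinarith [sq_nonneg (ρ.re - 1 / 2)]

lemma root_mul_sub_one_ne_zero {x : ℂ} (hx : x.im = 0) : ρ * x - 1 ≠ 0 := by
  intro h
  have h1 := congrArg Complex.im h
  have h2 := congrArg Complex.re h
  simp [hx, root_im_ne_zero hρ] at h1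
  simp [hx, h1] at h2

lemma root_exchange_ne_zero {x y : ℂ} (hx : x.im = 0 ∧ x ≠ 0) (hy : y.im = 0) :
    ρ * x - (1 - ρ) * y ≠ 0 := by
  intro h
  have h1 := congrArg Complex.im h
  have h2 := congrArg Complex.re h
  simp [hx.1, hy] at h1 h2
  have h3 : x.re + y.re = 0 := by
    apply mul_left_cancel₀ (root_im_ne_zero hρ); linarith
  have h4 : y.re = 0 := by linear_combination ρ.re * h3 - h2
  exact hx.2 (Complex.ext (by simp; linarith) (by simp [hx.1]))

lemma evenZ_perm {l l' : List ℂ} (h : l.Perm l') (hl : ∀ x ∈ l, x.im = 0 ∧ x ≠ 0)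
    (pre : List ℂ) : evenZ ρ (pre ++ l) = evenZ ρ (pre ++ l') := by
  induction h generalizing pre with
  | nil => rfl
  | cons x h ih =>
    simpa using ih (fun y hy => hl y (by simp [hy])) (pre ++ [x])
  | swap x y l =>
    have := (evenSum_exchangeAt hρ x y pre l).apply
      (root_exchange_ne_zero hρ (hl x (by simp)) (hl y (by simp)).1)
      (List.replicate l.length false)
    simpa [evenZ, List.replicate_add, List.replicate_succ] using this
  | trans h₁ h₂ ih₁ ih₂ =>
    rw [ih₁ hl, ih₂ fun x hx => hl x (h₁.mem_iff.2 hx)]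

lemma oddZ_perm {l l' : List ℂ} (h : l.Perm l') (hl : ∀ x ∈ l, x.im = 0 ∧ x ≠ 0)
    (pre : List ℂ) : oddZ ρ (pre ++ l) = oddZ ρ (pre ++ l') := by
  induction h generalizing pre with
  | nil => rfl
  | cons x h ih =>
    simpa using ih (fun y hy => hl y (by simp [hy])) (pre ++ [x])
  | swap x y l =>
    have := (oddSum_exchangeAt hρ x y (root_mul_sub_one_ne_zero hρ (hl x (by simp)).1)
      (root_mul_sub_one_ne_zero hρ (hl y (by simp)).1) pre l).apply
      (root_exchange_ne_zero hρ (hl x (by simp)) (hl y (by simp)).1)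
      (List.replicate l.length false)
    simpa [oddZ, List.replicate_add, List.replicate_succ] using this
  | trans h₁ h₂ ih₁ ih₂ =>
    rw [ih₁ hl, ih₂ fun x hx => hl x (h₁.mem_iff.2 hx)]

end root

section recursion

variable {ρ : ℂ}

lemma rowSum_true_replicate (x : ℂ) (ys : List ℂ) (Ψ : List Bool → ℂ) :
    rowSum ρ x ys true (List.replicate ys.length false) Ψ =
      (ys.map fun y => weightB ρ (x * y)).prod * Ψ (List.replicate ys.length false) := by
  induction ys generalizing Ψ with
  | nil => simp
  | cons y ys ih => simp [List.replicate_succ, ih, mul_assoc]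

lemma rowSum_append_true (x z : ℂ) (ys : List ℂ) (h : Bool) (vs : List Bool)
    (hv : vs.length = ys.length) (Ψ : List Bool → ℂ) :
    rowSum ρ x (ys ++ [z]) h (vs ++ [true]) Ψ =
      weightA ρ (x * z) * rowSum ρ x ys h vs (fun t => Ψ (t ++ [true])) := by
  induction ys generalizing h vs Ψ with
  | nil =>
    obtain rfl := List.length_eq_zero_iff.1 hv
    cases h <;> simp
  | cons y ys ih =>
    rcases vs with _ | ⟨v, vs⟩
    · simp at hv
    have := fun k => ih k vs (by simpa using hv)
    cases h <;> cases v <;> simp [this] <;> ring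

lemma evenSum_append_true (z : ℂ) (xs : List ℂ) (vs : List Bool) (hv : vs.length = xs.length) :
    evenSum ρ (xs ++ [z]) (vs ++ [true]) =
      (xs.map fun x => weightA ρ (x * z)).prod * evenSum ρ xs vs := by
  induction xs generalizing vs with
  | nil =>
    obtain rfl := List.length_eq_zero_iff.1 hv
    simp [evenSum]
  | cons x xs ih =>
    rcases vs with _ | ⟨v, vs⟩
    · simp at hv
    have hv' : vs.length = xs.length := by simpa using hv
    simp only [List.cons_append, evenSum, rowSum_append_true x z xs v vs hv', List.map_cons,
      List.prod_cons]
    rw [rowSum_congr _ _ _ _ (fun t ht => ih t ht), rowSum_smul]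
    ring

lemma oddSum_append_true (z : ℂ) (xs : List ℂ) (vs : List Bool) (hv : vs.length = xs.length) :
    oddSum ρ (xs ++ [z]) (vs ++ [true]) =
      (xs.map fun x => weightA ρ (x * z)).prod * oddSum ρ xs vs := by
  induction xs generalizing vs with
  | nil =>
    obtain rfl := List.length_eq_zero_iff.1 hv
    simp [oddSum]
  | cons x xs ih =>
    rcases vs with _ | ⟨v, vs⟩
    · simp at hv
    have hv' : vs.length = xs.length := by simpa using hv
    simp only [List.cons_append, oddSum, rowSum_append_true x z xs _ vs hv', List.map_cons,
      List.prod_cons]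
    rw [rowSum_congr _ _ _ _ (fun t ht => ih t ht), rowSum_smul,
      rowSum_congr _ _ _ _ (fun t ht => evenSum_append_true z xs t ht), rowSum_smul]
    ring

lemma rowSum_false_append_of_weightB (Y z : ℂ) (hb : weightB ρ (Y * z) = 0) (ys : List ℂ)
    (Ψ : List Bool → ℂ) :
    rowSum ρ Y (ys ++ [z]) false (List.replicate ys.length false ++ [false]) Ψ =
      (ys.map fun y => weightA ρ (Y * y)).prod * (Y * z) *
        Ψ (List.replicate ys.length false ++ [true]) := by
  induction ys generalizing Ψ with
  | nil => simp
  | cons y ys ih =>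
    have h := rowSum_true_replicate (ρ := ρ) Y (ys ++ [z]) (fun t => Ψ (true :: t))
    simp [hb, List.replicate_add] at h
    simp [List.replicate_succ, ih, h]
    ring

lemma evenZ_of_weightB (Y z : ℂ) (hb : weightB ρ (Y * z) = 0) (ys : List ℂ) :
    evenZ ρ (Y :: (ys ++ [z])) = Y * z * (ys.map fun y => weightA ρ (Y * y)).prod *
      (ys.map fun y => weightA ρ (y * z)).prod * evenZ ρ ys := by
  have h := rowSum_false_append_of_weightB Y z hb ys (evenSum ρ (ys ++ [z]))
  rw [evenSum_append_true _ _ _ (by simp)] at h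
  rw [evenZ, List.length_cons, List.replicate_succ, evenSum, List.length_append,
    List.length_singleton, List.replicate_add, List.replicate_one, h]
  simp only [evenZ]
  ring

lemma oddZ_of_weightB (Y z : ℂ) (hb : weightB ρ (Y * z) = 0) (ys : List ℂ) :
    oddZ ρ (Y :: (ys ++ [z])) = Y * z * (ys.map fun y => weightA ρ (Y * y)).prod *
      (ys.map fun y => weightA ρ (y * z)).prod * oddZ ρ ys := by
  have h := rowSum_false_append_of_weightB Y z hb ys (oddSum ρ (ys ++ [z]))
  have h' := rowSum_true_replicate (ρ := ρ) Y (ys ++ [z]) (evenSum ρ (ys ++ [z]))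
  simp [hb, List.replicate_add] at h'
  rw [oddSum_append_true _ _ _ (by simp)] at h
  rw [oddZ, List.length_cons, List.replicate_succ, oddSum, List.length_append,
    List.length_singleton, List.replicate_add, List.replicate_one, h, Bool.not_false, h']
  simp only [oddZ]
  ring

lemma evenZ_of_weightA (Y z : ℂ) (ha : weightA ρ (Y * z) = 0) (ys : List ℂ) :
    evenZ ρ (Y :: z :: ys) = Y * z * (ys.map fun y => weightB ρ (Y * y)).prod *
      (ys.map fun y => weightB ρ (z * y)).prod * evenZ ρ ys := by
  simp only [evenZ, List.length_cons, List.replicate_succ, evenSum, rowSum_false_false, ha,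
    rowSum_true_replicate]
  ring

lemma oddZ_of_weightA (hρ : ρ ^ 2 = ρ - 1) (Y z : ℂ) (hY : ρ * Y - 1 ≠ 0) (hz : Y * z = -ρ)
    (ys : List ℂ) :
    oddZ ρ (Y :: z :: ys) = Y * z * (ys.map fun y => weightB ρ (Y * y)).prod *
      (ys.map fun y => weightB ρ (z * y)).prod * oddZ ρ ys := by
  have ha : weightA ρ (Y * z) = 0 := by
    rw [hz, weightA]; linear_combination 1 / 3 * hρ
  have hY0 : Y ≠ 0 := by
    rintro rfl
    rw [zero_mul, eq_comm, neg_eq_zero] at hz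
    simp [hz] at hρ
  have hf : Y * z * weightF ρ true z + weightF ρ false Y * weightB ρ (Y * z) = 0 := by
    have hz' : ρ * z - 1 ≠ 0 := by
      intro h
      apply hY
      linear_combination (-ρ * Y) * h + ρ ^ 2 * hz - (ρ + 1) * hρ
    rw [hz]
    simp only [weightF, weightB, if_true, Bool.false_eq_true, if_false]
    field_simp
    have h3 : ρ ^ 3 = -1 := by linear_combination (ρ + 1) * hρ
    have h4 : ρ ^ 4 = -ρ := by linear_combination ρ * h3
    have h5 : ρ ^ 5 = -ρ ^ 2 := by linear_combination ρ ^ 2 * h3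
    linear_combination (norm := (ring_nf; simp only [hρ, h3, h4, h5]; ring))
      (ρ - 1) * (2 - ρ - ρ * (1 + ρ)) * ρ * hz
  simp only [oddZ, List.length_cons, List.replicate_succ, oddSum, rowSum_false_false, ha,
    rowSum_true_replicate, Bool.not_false, rowSum_true_false, Bool.not_true, evenSum]
  linear_combination (ys.map fun y => weightB ρ (Y * y)).prod * rowSum ρ z ys false
    (List.replicate ys.length false) (evenSum ρ ys) * hf

end recursion

section degree

open Polynomial

variable (ρ : ℂ)

lemma exists_polynomial_prod_weightB (ys : List ℂ) : ∃ P : ℂ[X], P.degree ≤ ys.length ∧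
    ∀ Y, (ys.map fun y => weightB ρ (Y * y)).prod = P.eval Y := by
  induction ys with
  | nil => exact ⟨1, by simp, by simp⟩
  | cons y ys ih =>
    obtain ⟨P, hP, h⟩ := ih
    refine ⟨(C ((1 + ρ) / 3 * y) * X + C ((2 - ρ) / 3)) * P, ?_, fun Y => ?_⟩
    · rw [degree_mul, List.length_cons, add_comm]
      push_cast
      exact add_le_add hP degree_linear_le
    · rw [List.map_cons, List.prod_cons, h, weightB]
      simp only [eval_mul, eval_add, eval_C, eval_X]
      ring

lemma exists_polynomial_rowSum_true (ys : List ℂ) (Ψ : List Bool → ℂ) :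
    ∃ P : ℂ[X], P.degree ≤ ys.length ∧
      ∀ Y, rowSum ρ Y ys true (List.replicate ys.length false) Ψ = P.eval Y := by
  obtain ⟨P, hP, h⟩ := exists_polynomial_prod_weightB ρ ys
  refine ⟨P * C (Ψ (List.replicate ys.length false)), ?_, fun Y => ?_⟩
  · exact (degree_mul_le _ _).trans (add_le_add hP degree_C_le |>.trans (by simp))
  · rw [rowSum_true_replicate, h]; simp

lemma exists_polynomial_rowSum_false (ys : List ℂ) (Ψ : List Bool → ℂ) :
    ∃ P : ℂ[X], P.degree < ys.length ∧
      ∀ Y, rowSum ρ Y ys false (List.replicate ys.length false) Ψ = Y * P.eval Y := by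
  induction ys generalizing Ψ with
  | nil => exact ⟨0, by simp, by simp⟩
  | cons y ys ih =>
    obtain ⟨P, hP, h⟩ := ih (fun t => Ψ (false :: t))
    obtain ⟨Q, hQ, h'⟩ := exists_polynomial_rowSum_true ρ ys (fun t => Ψ (true :: t))
    refine ⟨(C ((2 - ρ) / 3 * y) * X + C ((1 + ρ) / 3)) * P + C y * Q, ?_, fun Y => ?_⟩
    · refine (degree_add_le _ _).trans_lt (max_lt ?_ ?_)
      · rw [degree_mul, List.length_cons, add_comm]
        push_cast
        exact (add_le_add_right degree_linear_le _).trans_lt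
          (WithBot.add_lt_add_right (by simp) hP)
      · rw [degree_mul]
        refine (add_le_add degree_C_le hQ).trans_lt ?_
        simp only [zero_add, List.length_cons]
        exact_mod_cast Nat.lt_succ_self _
    · simp [List.replicate_succ, h, h', weightA]; ring

lemma exists_polynomial_evenZ (ys : List ℂ) :
    ∃ P : ℂ[X], P.degree < ys.length ∧ ∀ Y, evenZ ρ (Y :: ys) = Y * P.eval Y :=
  exists_polynomial_rowSum_false ρ ys (evenSum ρ ys)

end degree

/-- A complex number that is real and positive. -/
def PosReal (x : ℂ) : Prop := x.im = 0 ∧ 0 < x.re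

lemma PosReal.ne_zero {x : ℂ} (h : PosReal x) : x ≠ 0 := by
  rintro rfl; simpa using h.2

lemma PosReal.real {x : ℂ} (h : PosReal x) : x.im = 0 ∧ x ≠ 0 := ⟨h.1, h.ne_zero⟩

lemma weightA_one_sub (ρ u : ℂ) : weightA (1 - ρ) u = weightB ρ u := by
  rw [weightA, weightB]; ring

lemma weightB_one_sub (ρ u : ℂ) : weightB (1 - ρ) u = weightA ρ u := by
  rw [weightA, weightB]; ring

section interpolation

variable {ρ : ℂ} (hρ : ρ ^ 2 = ρ - 1)
include hρ

lemma root_ne_zero : ρ ≠ 0 := by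
  rintro rfl; simp at hρ

lemma root_one_sub : (1 - ρ) ^ 2 = (1 - ρ) - 1 := by linear_combination hρ

lemma weightB_root : weightB ρ (ρ ^ 2) = 0 := by
  rw [weightB]; linear_combination (ρ + 2) / 3 * hρ

lemma weightA_root : weightA ρ (-ρ) = 0 := by
  rw [weightA]; linear_combination 1 / 3 * hρ

lemma evenZ_div_root_mem {ys : List ℂ} (hys : ∀ y ∈ ys, y.im = 0 ∧ y ≠ 0) {z : ℂ} (hz : z ∈ ys) :
    evenZ ρ (ρ ^ 2 / z :: ys) =
      ρ ^ 2 * ((ys.erase z).map fun y => weightA ρ (ρ ^ 2 / z * y)).prod *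
        ((ys.erase z).map fun y => weightA ρ (y * z)).prod * evenZ ρ (ys.erase z) := by
  have h1 : ys.Perm (ys.erase z ++ [z]) :=
    (List.perm_cons_erase hz).trans (List.perm_append_singleton z (ys.erase z)).symm
  have h2 : ρ ^ 2 / z * z = ρ ^ 2 := div_mul_cancel₀ _ (hys z hz).2
  have := evenZ_perm hρ h1 hys [ρ ^ 2 / z]
  rw [List.singleton_append, List.singleton_append] at this
  rw [this, evenZ_of_weightB _ _ (by rw [h2, weightB_root hρ]), h2]

lemma evenZ_conj (n : ℕ) {xs : List ℂ} (hn : xs.length = 2 * n) (hxs : xs.Nodup)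
    (hpos : ∀ x ∈ xs, PosReal x) : evenZ (1 - ρ) xs = evenZ ρ xs := by
  induction n generalizing xs with
  | zero =>
    obtain rfl := List.length_eq_zero_iff.1 (by simpa using hn)
    simp [evenZ, evenSum]
  | succ n ih =>
    rcases xs with _ | ⟨Y, ys⟩
    · simp at hn
    obtain ⟨P, hP, hP'⟩ := exists_polynomial_evenZ ρ ys
    obtain ⟨Q, hQ, hQ'⟩ := exists_polynomial_evenZ (1 - ρ) ys
    have hys : ys.Nodup := (List.nodup_cons.1 hxs).2
    have hpos' : ∀ y ∈ ys, PosReal y := fun y hy => hpos y (by simp [hy])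
    have hcard : (ys.toFinset.image fun z => ρ ^ 2 / z).card = ys.length := by
      rw [card_image_of_injective, List.toFinset_card_of_nodup hys]
      intro a b hab
      simpa [div_eq_mul_inv, root_ne_zero hρ] using hab
    suffices Q = P by rw [hP', hQ', this]
    refine Polynomial.eq_of_degrees_lt_of_eval_finset_eq (ys.toFinset.image fun z => ρ ^ 2 / z)
      (by rwa [hcard]) (by rwa [hcard]) fun w hw => ?_
    obtain ⟨z, hz, rfl⟩ := mem_image.1 hw
    rw [List.mem_toFinset] at hz
    have hz0 := (hpos' z hz).ne_zero
    have hne : ρ ^ 2 / z ≠ 0 := div_ne_zero (pow_ne_zero _ (root_ne_zero hρ)) hz0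
    apply mul_left_cancel₀ hne
    rw [← hP', ← hQ', evenZ_div_root_mem hρ (fun y hy => (hpos' y hy).real) hz]
    have h2 : ρ ^ 2 / z * z = ρ ^ 2 := div_mul_cancel₀ _ hz0
    have := evenZ_perm (root_one_sub hρ) (List.perm_cons_erase hz)
      (fun y hy => (hpos' y hy).real) [ρ ^ 2 / z]
    rw [List.singleton_append, List.singleton_append] at this
    rw [this, evenZ_of_weightA _ _ (by rw [h2, weightA_one_sub, weightB_root hρ]), h2,
      ih _ (hys.erase z) fun y hy => hpos' y (List.mem_of_mem_erase hy)]
    · simp only [weightB_one_sub, mul_comm z]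
    · rw [List.length_erase_of_mem hz]
      simp at hn; omega

end interpolation

section odd

open Polynomial

lemma degree_le_of_degree_lt_succ {P : ℂ[X]} {N : ℕ} (h : P.degree < (N + 1 : ℕ)) :
    P.degree ≤ N :=
  (degree_le_iff_coeff_zero _ _).2 fun m hm =>
    (degree_lt_iff_coeff_zero _ _).1 h m (by exact_mod_cast hm)

variable {ρ : ℂ} (hρ : ρ ^ 2 = ρ - 1)
include hρ

lemma oddZ_div_root_mem {ys : List ℂ} (hys : ∀ y ∈ ys, y.im = 0 ∧ y ≠ 0) {z : ℂ} (hz : z ∈ ys) :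
    oddZ ρ (ρ ^ 2 / z :: ys) =
      ρ ^ 2 * ((ys.erase z).map fun y => weightA ρ (ρ ^ 2 / z * y)).prod *
        ((ys.erase z).map fun y => weightA ρ (y * z)).prod * oddZ ρ (ys.erase z) := by
  have h1 : ys.Perm (ys.erase z ++ [z]) :=
    (List.perm_cons_erase hz).trans (List.perm_append_singleton z (ys.erase z)).symm
  have h2 : ρ ^ 2 / z * z = ρ ^ 2 := div_mul_cancel₀ _ (hys z hz).2
  have := oddZ_perm hρ h1 hys [ρ ^ 2 / z]
  rw [List.singleton_append, List.singleton_append] at this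
  rw [this, oddZ_of_weightB _ _ (by rw [h2, weightB_root hρ]), h2]

lemma oddZ_conj_div_root_mem {ys : List ℂ} (hys : ∀ y ∈ ys, y.im = 0 ∧ y ≠ 0) {z : ℂ}
    (hz : z ∈ ys) :
    oddZ (1 - ρ) (ρ ^ 2 / z :: ys) =
      ρ ^ 2 * ((ys.erase z).map fun y => weightA ρ (ρ ^ 2 / z * y)).prod *
        ((ys.erase z).map fun y => weightA ρ (y * z)).prod * oddZ (1 - ρ) (ys.erase z) := by
  have h2 : ρ ^ 2 / z * z = ρ ^ 2 := div_mul_cancel₀ _ (hys z hz).2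
  have := oddZ_perm (root_one_sub hρ) (List.perm_cons_erase hz) hys [ρ ^ 2 / z]
  rw [List.singleton_append, List.singleton_append] at this
  rw [this, oddZ_of_weightA (root_one_sub hρ) _ _ _ (by rw [h2]; linear_combination hρ), h2]
  · simp only [weightB_one_sub, mul_comm z]
  · intro h
    have h3 : (1 - ρ) * (ρ ^ 2 / z) = ρ / z := by
      rw [← mul_div_assoc]; congr 1; linear_combination (-ρ) * hρ
    have h4 : ρ = z := by
      rw [h3, sub_eq_zero, div_eq_one_iff_eq (hys z hz).2] at h
      exact h
    exact root_im_ne_zero hρ (h4 ▸ (hys z hz).1)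

lemma evenZ_append_neg_one_div_root_mem {ys : List ℂ} (hys : ∀ y ∈ ys, y.im = 0 ∧ y ≠ 0) {z : ℂ}
    (hz : z ∈ ys) :
    evenZ ρ (ρ ^ 2 / z :: (ys ++ [-1])) =
      ρ ^ 2 * ((ys.erase z).map fun y => weightA ρ (ρ ^ 2 / z * y)).prod *
        weightA ρ (ρ ^ 2 / z * -1) *
        (((ys.erase z).map fun y => weightA ρ (y * z)).prod * weightA ρ (-1 * z)) *
        evenZ ρ (ys.erase z ++ [-1]) := by
  have := evenZ_div_root_mem hρ (ys := ys ++ [-1]) (z := z) (by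
    intro y hy
    rcases List.mem_append.1 hy with hy | hy
    · exact hys y hy
    · simp at hy; simp [hy]) (by simp [hz])
  rw [this, List.erase_append_left _ hz]
  simp only [List.map_append, List.prod_append, List.map_cons, List.map_nil, List.prod_cons,
    List.prod_nil, mul_one]
  ring

/-- The polynomial in the first parameter whose vanishing expresses the relation between
`oddZ` and `evenZ`. -/
lemma exists_polynomial_oddZ_add {N : ℕ} {ys : List ℂ} (hN : ys.length = N + 1) :
    ∃ P : ℂ[X], P.degree < (N + 3 : ℕ) ∧
      (∀ Y, ρ * Y - 1 ≠ 0 → (1 - ρ) * Y - 1 ≠ 0 →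
        (Y ^ 2 - Y + 1) * (oddZ ρ (Y :: ys) + oddZ (1 - ρ) (Y :: ys)) = Y * P.eval Y) ∧
      P.eval (1 - ρ) = (ρ - 1) * ((1 - ρ) ^ 2 - 1) *
        ((ys.map fun y => weightB ρ ((1 - ρ) * y)).prod * evenZ ρ ys) ∧
      P.eval ρ = -ρ * (ρ ^ 2 - 1) *
        ((ys.map fun y => weightA ρ (ρ * y)).prod * evenZ (1 - ρ) ys) := by
  obtain ⟨P, hP, hP'⟩ := exists_polynomial_rowSum_false ρ ys (oddSum ρ ys)
  obtain ⟨Q, hQ, hQ'⟩ := exists_polynomial_rowSum_true ρ ys (evenSum ρ ys)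
  obtain ⟨P₁, hP₁, hP₁'⟩ := exists_polynomial_rowSum_false (1 - ρ) ys (oddSum (1 - ρ) ys)
  obtain ⟨Q₁, hQ₁, hQ₁'⟩ := exists_polynomial_rowSum_true (1 - ρ) ys (evenSum (1 - ρ) ys)
  have hD : ∀ Y, Y ^ 2 - Y + 1 = (ρ * Y - 1) * ((1 - ρ) * Y - 1) := fun Y => by
    linear_combination Y ^ 2 * hρ
  rw [hN] at hP hQ hP₁ hQ₁
  refine ⟨(C 1 * X ^ 2 + C (-1) * X + C 1) * (P + P₁) + C (ρ - 1) * ((C (1 - ρ) * X + C (-1)) * Q) +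
    C (-ρ) * ((C ρ * X + C (-1)) * Q₁), ?_, fun Y h1 h2 => ?_, ?_, ?_⟩
  · refine lt_of_le_of_lt (b := ((N + 2 : ℕ) : WithBot ℕ)) ?_
      (by exact_mod_cast Nat.lt_succ_self _)
    replace hP := degree_le_of_degree_lt_succ hP
    replace hP₁ := degree_le_of_degree_lt_succ hP₁
    have e1 : ((N + 2 : ℕ) : WithBot ℕ) = 2 + (N : WithBot ℕ) := by push_cast; ring
    have e2 : ((N + 2 : ℕ) : WithBot ℕ) = 0 + (1 + ((N + 1 : ℕ) : WithBot ℕ)) := by push_cast; ring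
    refine degree_add_le_of_degree_le (degree_add_le_of_degree_le ?_ ?_) ?_
    · rw [e1]
      exact degree_mul_le_of_le degree_quadratic_le ((degree_add_le _ _).trans (max_le hP hP₁))
    · rw [e2]
      exact degree_mul_le_of_le degree_C_le (degree_mul_le_of_le degree_linear_le hQ)
    · rw [e2]
      exact degree_mul_le_of_le degree_C_le (degree_mul_le_of_le degree_linear_le hQ₁)
  · have h3 : oddZ ρ (Y :: ys) = Y * P.eval Y + weightF ρ false Y * Q.eval Y := by
      rw [← hP', ← hQ']; rfl
    have h4 : oddZ (1 - ρ) (Y :: ys) = Y * P₁.eval Y + weightF (1 - ρ) false Y * Q₁.eval Y := by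
      rw [← hP₁', ← hQ₁']; rfl
    have h5 : (ρ * Y - 1) * weightF ρ false Y = (ρ - 1) * Y := by
      rw [weightF, mul_div_cancel₀ _ h1]; simp
    have h6 : ((1 - ρ) * Y - 1) * weightF (1 - ρ) false Y = -ρ * Y := by
      rw [weightF, mul_div_cancel₀ _ h2]; simp
    rw [h3, h4]
    simp only [eval_add, eval_mul, eval_C, eval_X, eval_pow]
    linear_combination (Q.eval Y * weightF ρ false Y + Q₁.eval Y * weightF (1 - ρ) false Y) * hD Y +
      Q.eval Y * ((1 - ρ) * Y - 1) * h5 + Q₁.eval Y * (ρ * Y - 1) * h6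
  · have h3 : Q.eval (1 - ρ) = (ys.map fun y => weightB ρ ((1 - ρ) * y)).prod * evenZ ρ ys := by
      rw [← hQ', rowSum_true_replicate]; rfl
    rw [← h3]
    simp only [eval_add, eval_mul, eval_C, eval_X, eval_pow]
    linear_combination (P.eval (1 - ρ) + P₁.eval (1 - ρ) + ρ * Q₁.eval (1 - ρ)) * hρ
  · have h3 : Q₁.eval ρ = (ys.map fun y => weightA ρ (ρ * y)).prod * evenZ (1 - ρ) ys := by
      rw [← hQ₁', rowSum_true_replicate]
      simp only [weightB_one_sub]; rfl
    rw [← h3]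
    simp only [eval_add, eval_mul, eval_C, eval_X, eval_pow]
    linear_combination (P.eval ρ + P₁.eval ρ - (ρ - 1) * Q.eval ρ) * hρ

end odd

section odd

open Polynomial

variable {ρ : ℂ} (hρ : ρ ^ 2 = ρ - 1)
include hρ

omit hρ in
lemma PosReal.add_one_ne_zero {x : ℂ} (h : PosReal x) : x + 1 ≠ 0 := by
  intro h0
  have := congrArg Complex.re h0
  simp at this
  linarith [h.2]

omit hρ in
lemma PosReal.sq_sub_add_one_ne_zero {x : ℂ} (h : PosReal x) : x ^ 2 - x + 1 ≠ 0 := by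
  intro h0
  have := congrArg Complex.re h0
  simp [pow_two, h.1] at this
  nlinarith [sq_nonneg (x.re - 1 / 2)]

omit hρ in
lemma prod_map_eq_pow_mul_of_sq {c d : ℂ} {k : ℕ} {ys : List ℂ} (hk : ys.length = 2 * k)
    (hc : c ^ 2 = d) {f g : ℂ → ℂ} (h : ∀ y ∈ ys, f y = c * g y) :
    (ys.map f).prod = d ^ k * (ys.map g).prod := by
  rw [List.map_congr_left h, List.prod_map_mul, List.map_const', List.prod_replicate, hk, pow_mul,
    hc]

lemma oddZ_add_oddZ_conj_singleton {x : ℂ} (hx : PosReal x) :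
    oddZ ρ [x] + oddZ (1 - ρ) [x] = -((x + 1) / (x ^ 2 - x + 1)) * evenZ ρ [x, -1] := by
  have h1 := root_mul_sub_one_ne_zero hρ hx.1
  have h2 := root_mul_sub_one_ne_zero (root_one_sub hρ) hx.1
  have h3 : x ^ 2 - x + 1 = (ρ * x - 1) * ((1 - ρ) * x - 1) := by
    linear_combination x ^ 2 * hρ
  have h5 : (ρ * x - 1) * weightF ρ false x = (ρ - 1) * x := by
    rw [weightF, mul_div_cancel₀ _ h1]; simp
  have h6 : ((1 - ρ) * x - 1) * weightF (1 - ρ) false x = -ρ * x := by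
    rw [weightF, mul_div_cancel₀ _ h2]; simp
  have h7 : (x ^ 2 - x + 1) * ((x + 1) / (x ^ 2 - x + 1)) = x + 1 :=
    mul_div_cancel₀ _ hx.sq_sub_add_one_ne_zero
  apply mul_left_cancel₀ hx.sq_sub_add_one_ne_zero
  generalize (x + 1) / (x ^ 2 - x + 1) = g at h7 ⊢
  simp only [oddZ, evenZ, oddSum, evenSum, List.length_cons, List.length_nil, zero_add,
    List.replicate_succ, List.replicate_zero, rowSum_nil, Bool.false_eq_true, if_false,
    Bool.not_false, if_true, rowSum_false_false, mul_zero, mul_one]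
  linear_combination (weightF ρ false x + weightF (1 - ρ) false x) * h3 +
    ((1 - ρ) * x - 1) * h5 + (ρ * x - 1) * h6 - x * h7 - 2 * x ^ 2 * hρ

lemma oddZ_add_oddZ_conj (n : ℕ) {xs : List ℂ} (hn : xs.length = 2 * n + 1) (hxs : xs.Nodup)
    (hpos : ∀ x ∈ xs, PosReal x) :
    oddZ ρ xs + oddZ (1 - ρ) xs =
      -(-3) ^ n * (xs.map fun x => (x + 1) / (x ^ 2 - x + 1)).prod * evenZ ρ (xs ++ [-1]) := by
  have h3 : ρ ^ 3 = -1 := by linear_combination (ρ + 1) * hρ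
  have h4 : ρ ^ 4 = -ρ := by linear_combination ρ * h3
  have h5 : ρ ^ 5 = -ρ ^ 2 := by linear_combination ρ ^ 2 * h3
  have h6 : ρ ^ 6 = 1 := by linear_combination (ρ ^ 3 - 1) * h3
  induction n generalizing xs with
  | zero =>
    obtain ⟨x, rfl⟩ := List.length_eq_one_iff.1 hn
    simpa using oddZ_add_oddZ_conj_singleton hρ (hpos x (by simp))
  | succ n ih =>
    rcases xs with _ | ⟨Y, ys⟩
    · simp at hn
    have hlen : ys.length = 2 * (n + 1) := by simpa using hn
    have hys : ys.Nodup := (List.nodup_cons.1 hxs).2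
    have hpos' : ∀ y ∈ ys, PosReal y := fun y hy => hpos y (by simp [hy])
    have hreal : ∀ y ∈ ys, y.im = 0 ∧ y ≠ 0 := fun y hy => (hpos' y hy).real
    obtain ⟨P, hP, hP', hP₁, hP₂⟩ := exists_polynomial_oddZ_add hρ (N := 2 * n + 1) hlen
    obtain ⟨R, hR, hR'⟩ := exists_polynomial_evenZ ρ (ys ++ [-1])
    set c := -(-3) ^ (n + 1) * (ys.map fun x => (x + 1) / (x ^ 2 - x + 1)).prod with hc
    have hρ0 := root_ne_zero hρ
    have him := root_im_ne_zero hρ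
    have hcard : ((insert ρ (insert (-1) ys.toFinset)).image fun z => ρ ^ 2 / z).card =
        2 * n + 1 + 3 := by
      rw [card_image_of_injective, card_insert_of_notMem, card_insert_of_notMem,
        List.toFinset_card_of_nodup hys, hlen]
      · ring
      · intro h
        have := (hpos' _ (List.mem_toFinset.1 h)).2
        norm_num at this
      · intro h
        rcases mem_insert.1 h with h | h
        · exact him (by rw [h]; simp)
        · exact him (hpos' _ (List.mem_toFinset.1 h)).1
      · intro a b hab
        simpa [div_eq_mul_inv, hρ0] using hab
    have key : P = C c * ((C 1 * X + C 1) * R) := by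
      refine Polynomial.eq_of_degrees_lt_of_eval_finset_eq
        ((insert ρ (insert (-1) ys.toFinset)).image fun z => ρ ^ 2 / z)
        (by rwa [hcard]) ?_ fun w hw => ?_
      · rw [hcard]
        refine lt_of_le_of_lt (b := ((2 * n + 1 + 2 : ℕ) : WithBot ℕ)) ?_
          (by exact_mod_cast Nat.lt_succ_self _)
        rw [List.length_append, List.length_singleton, hlen] at hR
        have e : ((2 * n + 1 + 2 : ℕ) : WithBot ℕ) =
          0 + (1 + ((2 * (n + 1) : ℕ) : WithBot ℕ)) := by push_cast; ring
        rw [e]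
        exact degree_mul_le_of_le degree_C_le
          (degree_mul_le_of_le degree_linear_le (degree_le_of_degree_lt_succ hR))
      obtain ⟨z, hz, rfl⟩ := mem_image.1 hw
      simp only [eval_mul, eval_add, eval_C, eval_X, one_mul]
      rcases mem_insert.1 hz with h | hz
      · have e : ρ ^ 2 / ρ = ρ := by field_simp
        rw [h, e]
        have hE : evenZ ρ (ρ :: (ys ++ [-1])) = evenZ ρ (ρ :: -1 :: ys) :=
          evenZ_perm hρ (List.perm_append_singleton _ _) (by
            intro y hy
            rcases List.mem_append.1 hy with hy | hy
            · exact hreal y hy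
            · simp at hy; simp [hy]) [ρ]
        rw [evenZ_of_weightA _ _ (by rw [mul_neg_one, weightA_root hρ]), hR'] at hE
        rw [hP₂, evenZ_conj hρ _ hlen hys hpos']
        apply mul_left_cancel₀ hρ0
        have hprod := prod_map_eq_pow_mul_of_sq (c := -(2 * ρ - 1) / 3) (d := -1 / 3) hlen
          (by linear_combination 4 / 9 * hρ)
          (f := fun y => (y + 1) / (y ^ 2 - y + 1) * (weightB ρ (ρ * y) * weightB ρ (-1 * y)))
          (g := fun y => weightA ρ (ρ * y)) (fun y hy => by
            rw [div_mul_eq_mul_div, div_eq_iff (hpos' y hy).sq_sub_add_one_ne_zero]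
            simp only [weightA, weightB]
            ring_nf
            simp only [hρ, h3]
            ring)
        rw [List.prod_map_mul, List.prod_map_mul] at hprod
        rw [show ρ * (c * ((ρ + 1) * R.eval ρ)) = c * (ρ + 1) * (ρ * R.eval ρ) by ring, hE, hc]
        have h5 : (-3 : ℂ) ^ (n + 1) * (-1 / 3) ^ (n + 1) = 1 := by
          rw [← mul_pow]; norm_num
        linear_combination -(-3 : ℂ) ^ (n + 1) * (ρ + 1) * (ρ * evenZ ρ ys) * hprod -
          (ρ + 1) * ρ * evenZ ρ ys * (ys.map fun y => weightA ρ (ρ * y)).prod * h5 -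
          ρ * (ρ + 1) * evenZ ρ ys * (ys.map fun y => weightA ρ (ρ * y)).prod * hρ
      rcases mem_insert.1 hz with rfl | hz
      · have e : ρ ^ 2 / -1 = 1 - ρ := by linear_combination -hρ
        rw [e]
        have hE := evenZ_of_weightB (ρ := ρ) (1 - ρ) (-1)
          (by rw [← e, div_mul_cancel₀ _ (by norm_num), weightB_root hρ]) ys
        rw [hR'] at hE
        rw [hP₁]
        have hne : 1 - ρ ≠ 0 := root_ne_zero (root_one_sub hρ)
        apply mul_left_cancel₀ hne
        have hprod := prod_map_eq_pow_mul_of_sq (c := (2 * ρ - 1) / 3) (d := -1 / 3) hlen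
          (by linear_combination 4 / 9 * hρ)
          (f := fun y => (y + 1) / (y ^ 2 - y + 1) *
            (weightA ρ ((1 - ρ) * y) * weightA ρ (y * -1)))
          (g := fun y => weightB ρ ((1 - ρ) * y)) (fun y hy => by
            rw [div_mul_eq_mul_div, div_eq_iff (hpos' y hy).sq_sub_add_one_ne_zero]
            simp only [weightA, weightB]
            ring_nf
            simp only [hρ, h3]
            ring)
        rw [List.prod_map_mul, List.prod_map_mul] at hprod
        rw [show (1 - ρ) * (c * (((1 - ρ) + 1) * R.eval (1 - ρ))) =
          c * ((1 - ρ) + 1) * ((1 - ρ) * R.eval (1 - ρ)) by ring, hE, hc]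
        have h5 : (-3 : ℂ) ^ (n + 1) * (-1 / 3) ^ (n + 1) = 1 := by
          rw [← mul_pow]; norm_num
        linear_combination -(-3 : ℂ) ^ (n + 1) * (2 - ρ) * ((1 - ρ) * evenZ ρ ys) * hprod -
          (2 - ρ) * (1 - ρ) * evenZ ρ ys * (ys.map fun y => weightB ρ ((1 - ρ) * y)).prod * h5 -
          (1 - ρ) * (2 - ρ) * evenZ ρ ys * (ys.map fun y => weightB ρ ((1 - ρ) * y)).prod * hρ
      rw [List.mem_toFinset] at hz
      have hz0 := (hpos' z hz).ne_zero
      have hW : ρ ^ 2 / z * z = ρ ^ 2 := div_mul_cancel₀ _ hz0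
      have h1 : ρ * (ρ ^ 2 / z) - 1 ≠ 0 := by
        intro h
        apply (hpos' z hz).add_one_ne_zero
        linear_combination ρ * hW - z * h + (ρ + 1) * hρ
      have h2 : (1 - ρ) * (ρ ^ 2 / z) - 1 ≠ 0 := by
        intro h
        have : ρ = z := by linear_combination (ρ - 1) * hW + z * h + ρ * hρ
        exact him (this ▸ (hpos' z hz).1)
      apply mul_left_cancel₀ (div_ne_zero (pow_ne_zero 2 hρ0) hz0)
      rw [← hP' _ h1 h2, oddZ_div_root_mem hρ hreal hz, oddZ_conj_div_root_mem hρ hreal hz,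
        ← mul_add, ih _ (hys.erase z) (fun y hy => hpos' y (List.mem_of_mem_erase hy))]
      · have hE := evenZ_append_neg_one_div_root_mem hρ hreal hz
        rw [hR'] at hE
        rw [show ρ ^ 2 / z * (c * ((ρ ^ 2 / z + 1) * R.eval (ρ ^ 2 / z))) =
          c * (ρ ^ 2 / z + 1) * (ρ ^ 2 / z * R.eval (ρ ^ 2 / z)) by ring, hE, hc,
          ((List.perm_cons_erase hz).map _).prod_eq, List.map_cons, List.prod_cons]
        have hs : (ρ ^ 2 / z) ^ 2 - ρ ^ 2 / z + 1 = -3 * ((z + 1) / (z ^ 2 - z + 1)) *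
            (ρ ^ 2 / z + 1) * weightA ρ (ρ ^ 2 / z * -1) * weightA ρ (-1 * z) := by
          have hg : (z ^ 2 - z + 1) * ((z + 1) / (z ^ 2 - z + 1)) = z + 1 :=
            mul_div_cancel₀ _ (hpos' z hz).sq_sub_add_one_ne_zero
          apply mul_left_cancel₀ (hpos' z hz).sq_sub_add_one_ne_zero
          generalize (z + 1) / (z ^ 2 - z + 1) = g at hg ⊢
          generalize ρ ^ 2 / z = W at hW ⊢
          simp only [weightA]
          linear_combination (norm := (ring_nf; simp only [hρ, h3, h4, h5, h6]; ring))
            3 * (W + 1) * (((2 - ρ) * (W * -1) + (1 + ρ)) / 3) *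
              (((2 - ρ) * (-1 * z) + (1 + ρ)) / 3) * hg +
            (W * z + ρ ^ 2 - z - W + 1 + ((2 - ρ) ^ 2 * (W * z + ρ ^ 2 + z + W + 1) -
              (2 - ρ) * (1 + ρ) * (z + W) + (1 + ρ) ^ 2) / 3 - 2) * hW
        rw [hs]
        ring
      · rw [List.length_erase_of_mem hz, hlen]; omega
    have h1 := root_mul_sub_one_ne_zero hρ (hpos Y (by simp)).1
    have h2 := root_mul_sub_one_ne_zero (root_one_sub hρ) (hpos Y (by simp)).1
    have hY := hP' Y h1 h2
    have hD := (hpos Y (by simp)).sq_sub_add_one_ne_zero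
    apply mul_left_cancel₀ hD
    rw [hY, key, List.cons_append, hR', List.map_cons, List.prod_cons]
    simp only [eval_mul, eval_add, eval_C, eval_X, one_mul]
    have h5 : (Y ^ 2 - Y + 1) * ((Y + 1) / (Y ^ 2 - Y + 1)) = Y + 1 := mul_div_cancel₀ _ hD
    rw [hc]
    linear_combination (-3) ^ (n + 1) * (ys.map fun x => (x + 1) / (x ^ 2 - x + 1)).prod * Y *
      R.eval Y * h5

end odd

section trisection

open Polynomial

lemma sum_range_three_mul {M : Type*} [AddCommMonoid M] (f : ℕ → M) (m : ℕ) :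
    ∑ i ∈ range (3 * m), f i = ∑ j ∈ range m, (f (3 * j) + f (3 * j + 1) + f (3 * j + 2)) := by
  induction m with
  | zero => simp
  | succ m ih =>
    rw [show 3 * (m + 1) = 3 * m + 1 + 1 + 1 by ring, sum_range_succ, sum_range_succ,
      sum_range_succ, ih, sum_range_succ]
    simp only [add_assoc]

lemma exists_polynomial_eval_cube {ω : ℂ} (hω : ω ^ 2 + ω + 1 = 0) {m : ℕ} {H : ℂ[X]}
    (hH : H.natDegree < 3 * m) :
    ∃ K : ℂ[X], K.degree < m ∧
      ∀ Y, H.eval Y + H.eval (ω * Y) + H.eval (ω ^ 2 * Y) = K.eval (Y ^ 3) := by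
  have h3 : ω ^ 3 = 1 := by linear_combination (ω - 1) * hω
  refine ⟨∑ j ∈ range m, C (3 * H.coeff (3 * j)) * X ^ j, ?_, fun Y => ?_⟩
  · refine (degree_lt_iff_coeff_zero _ _).2 fun k hk => ?_
    rw [finsetSum_coeff]
    refine sum_eq_zero fun j hj => ?_
    rw [coeff_C_mul_X_pow, if_neg]
    have := mem_range.1 hj
    omega
  · rw [eval_eq_sum_range' hH, eval_eq_sum_range' hH, eval_eq_sum_range' hH, ← sum_add_distrib,
      ← sum_add_distrib, sum_range_three_mul, eval_finsetSum]
    refine sum_congr rfl fun j _ => ?_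
    simp only [mul_pow, eval_mul, eval_C, eval_pow, eval_X, ← pow_mul, pow_add]
    simp only [mul_comm 2 (3 * j), pow_mul ω, h3, one_pow, pow_mul Y, mul_assoc]
    linear_combination (H.coeff (3 * j + 1) * (Y ^ 3) ^ j * Y) * hω +
      (H.coeff (3 * j + 2) * (Y ^ 3) ^ j * Y ^ 2) * (hω + (ω : ℂ) * h3)

end trisection

lemma PosReal.inv_pow_injOn {k : ℕ} (hk : k ≠ 0) :
    Set.InjOn (fun x : ℂ => x⁻¹ ^ k) {x | PosReal x} := by
  intro x hx y hy h
  have h1 : x = (x.re : ℂ) := Complex.ext rfl (by simpa using hx.1)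
  have h2 : y = (y.re : ℂ) := Complex.ext rfl (by simpa using hy.1)
  have hx' := hx.2
  have hy' := hy.2
  rw [h1, h2] at h ⊢
  simp only [inv_pow, inv_inj] at h
  norm_cast at h ⊢
  exact (pow_left_inj₀ hx'.le hy'.le hk).1 h

section three

open Polynomial

variable {ρ : ℂ} (hρ : ρ ^ 2 = ρ - 1)
include hρ

lemma evenZ_sum_root_mul {n : ℕ} {xs : List ℂ} (hn : xs.length = 2 * n + 1) (hxs : xs.Nodup)
    (hpos : ∀ x ∈ xs, PosReal x) {h : ℂ → ℂ}
    (hh : ∀ Y, h Y = evenZ ρ (Y :: xs) * ((Y ^ 2 - 1) *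
      (xs.map fun x => (Y - x) * (Y * x - 1)).prod)) (Y : ℂ) :
    h Y + h (ρ ^ 2 * Y) + h ((ρ ^ 2) ^ 2 * Y) = 0 := by
  have h3 : ρ ^ 3 = -1 := by linear_combination (ρ + 1) * hρ
  have h4 : ρ ^ 4 = -ρ := by linear_combination ρ * h3
  have h5 : ρ ^ 5 = -ρ ^ 2 := by linear_combination ρ ^ 2 * h3
  have h6 : ρ ^ 6 = 1 := by linear_combination (ρ ^ 3 - 1) * h3
  have h7 : ρ ^ 7 = ρ := by linear_combination ρ * h6
  have h8 : ρ ^ 8 = ρ ^ 2 := by linear_combination ρ ^ 2 * h6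
  have hω : (ρ ^ 2) ^ 2 + ρ ^ 2 + 1 = 0 := by linear_combination h4 + hρ
  have hreal : ∀ x ∈ xs, x.im = 0 ∧ x ≠ 0 := fun x hx => (hpos x hx).real
  obtain ⟨P, hP, hP'⟩ := exists_polynomial_evenZ ρ xs
  let H : ℂ[X] := X * P * ((X ^ 2 - C 1) * (xs.map fun x => (X - C x) * (C x * X - C 1)).prod)
  have hH : ∀ Y, H.eval Y = h Y := by
    intro Y
    rw [hh, hP']
    simp only [H, eval_mul, eval_X, eval_sub, eval_pow, eval_C, eval_list_prod, List.map_map]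
    congr 4
    ext x
    simp only [Function.comp, eval_mul, eval_X, eval_sub, eval_C]
    ring
  have hdeg : H.natDegree < 3 * (2 * n + 2) := by
    have e1 : P.natDegree ≤ 2 * n := by
      rw [natDegree_le_iff_degree_le]
      rw [hn] at hP
      exact degree_le_of_degree_lt_succ hP
    have e2 : (xs.map fun x : ℂ => (X - C x) * (C x * X - C 1)).prod.natDegree ≤
        2 * xs.length := by
      clear * -
      induction xs with
      | nil => simp
      | cons x xs ih =>
        rw [List.map_cons, List.prod_cons, List.length_cons]
        refine (natDegree_mul_le_of_le (natDegree_mul_le_of_le (natDegree_X_sub_C_le _)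
          (show (C x * X - C 1).natDegree ≤ 1 by compute_degree)) ih).trans ?_
        omega
    have e3 : (X ^ 2 - C 1 : ℂ[X]).natDegree ≤ 2 := by compute_degree
    have := natDegree_mul_le_of_le (natDegree_mul_le_of_le natDegree_X_le e1)
      (natDegree_mul_le_of_le e3 e2)
    rw [hn] at this
    exact this.trans_lt (by omega)
  obtain ⟨K, hK, hK'⟩ := exists_polynomial_eval_cube hω hdeg
  simp only [hH] at hK'
  rw [hK']
  suffices K = 0 by simp [this]
  have hcard : (insert 0 (xs.toFinset.image fun x => x⁻¹ ^ 3)).card = 2 * n + 2 := by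
    rw [card_insert_of_notMem, card_image_of_injOn, List.toFinset_card_of_nodup hxs, hn]
    · intro x hx y hy
      exact PosReal.inv_pow_injOn (by norm_num) (hpos x (by simpa using hx))
        (hpos y (by simpa using hy))
    · intro h0
      obtain ⟨x, hx, hx0⟩ := mem_image.1 h0
      exact pow_ne_zero 3 (inv_ne_zero (hpos x (List.mem_toFinset.1 hx)).ne_zero) hx0
  refine eq_zero_of_degree_lt_of_eval_finset_eq_zero
    (insert 0 (xs.toFinset.image fun x => x⁻¹ ^ 3)) (by rwa [hcard]) fun w hw => ?_
  rcases mem_insert.1 hw with rfl | hw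
  · have := hK' 0
    have h0 : h 0 = 0 := by simp [hh, hP']
    simpa [h0] using this.symm
  obtain ⟨x, hx, rfl⟩ := mem_image.1 hw
  rw [List.mem_toFinset] at hx
  rw [← hK']
  have hx0 := (hpos x hx).ne_zero
  have hW : x⁻¹ * x = 1 := inv_mul_cancel₀ hx0
  generalize x⁻¹ = W at hW
  set ys := xs.erase x with hys
  have hp : xs.Perm (x :: ys) := List.perm_cons_erase hx
  have hprod : ∀ f : ℂ → ℂ, (xs.map f).prod = f x * (ys.map f).prod := by
    intro f
    rw [(hp.map f).prod_eq, List.map_cons, List.prod_cons]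
  have hA : h (ρ ^ 2 * W) = ρ ^ 2 * (ys.map fun y => weightA ρ (ρ ^ 2 * W * y)).prod *
      (ys.map fun y => weightA ρ (y * x)).prod * evenZ ρ ys * (((ρ ^ 2 * W) ^ 2 - 1) *
      ((ρ ^ 2 * W - x) * (ρ ^ 2 - 1) *
        (ys.map fun y => (ρ ^ 2 * W - y) * (ρ ^ 2 * W * y - 1)).prod)) := by
    have e : ρ ^ 2 * W * x = ρ ^ 2 := by rw [mul_assoc, hW, mul_one]
    have := evenZ_perm hρ (hp.trans (List.perm_append_singleton x ys).symm) hreal [ρ ^ 2 * W]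
    rw [hh, hprod]
    simp only [List.singleton_append] at this
    rw [this, evenZ_of_weightB _ _ (by rw [e, weightB_root hρ]), e]
  have hB : h ((ρ ^ 2) ^ 2 * W) = -ρ * (ys.map fun y => weightB ρ (-ρ * W * y)).prod *
      (ys.map fun y => weightB ρ (x * y)).prod * evenZ ρ ys * (((-ρ * W) ^ 2 - 1) *
      ((-ρ * W - x) * (-ρ - 1) *
        (ys.map fun y => (-ρ * W - y) * (-ρ * W * y - 1)).prod)) := by
    have e0 : (ρ ^ 2) ^ 2 = -ρ := by rw [← h4]; ring
    have e : -ρ * W * x = -ρ := by rw [mul_assoc, hW, mul_one]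
    have := evenZ_perm hρ hp hreal [-ρ * W]
    rw [e0, hh, hprod]
    simp only [List.singleton_append] at this
    rw [this, evenZ_of_weightA _ _ (by rw [e, weightA_root hρ]), e]
  have hC : h W = 0 := by
    rw [hh, hprod, hW]; simp
  have key : (ys.map fun y => weightA ρ (ρ ^ 2 * W * y)).prod *
        (ys.map fun y => weightA ρ (y * x)).prod *
        (ys.map fun y => (ρ ^ 2 * W - y) * (ρ ^ 2 * W * y - 1)).prod =
      (ys.map fun y => weightB ρ (-ρ * W * y)).prod * (ys.map fun y => weightB ρ (x * y)).prod *
        (ys.map fun y => (-ρ * W - y) * (-ρ * W * y - 1)).prod := by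
    simp only [← List.prod_map_mul]
    congr 1
    refine List.map_congr_left fun y _ => ?_
    obtain rfl : W = x⁻¹ := eq_inv_of_mul_eq_one_left hW
    simp only [weightA, weightB]
    field_simp
    ring_nf
    simp only [hρ, h3, h4, h5, h6, h7, h8]
    ring
  rw [hA, hB, hC]
  have pre : ρ ^ 2 * ((ρ ^ 2 * W) ^ 2 - 1) * (ρ ^ 2 * W - x) * (ρ ^ 2 - 1) +
      -ρ * ((-ρ * W) ^ 2 - 1) * (-ρ * W - x) * (-ρ - 1) = 0 := by
    obtain rfl : W = x⁻¹ := eq_inv_of_mul_eq_one_left hW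
    field_simp
    ring_nf
    simp only [hρ, h4, h5, h8]
    linear_combination h4 + ρ ^ 4 * h6
  linear_combination evenZ ρ ys * ρ ^ 2 * ((ρ ^ 2 * W) ^ 2 - 1) * (ρ ^ 2 * W - x) * (ρ ^ 2 - 1) *
    key + evenZ ρ ys * ((ys.map fun y => weightB ρ (-ρ * W * y)).prod *
      (ys.map fun y => weightB ρ (x * y)).prod *
        (ys.map fun y => (-ρ * W - y) * (-ρ * W * y - 1)).prod) * pre

end three

section continuity

open Filter Topology

variable {α : Type*} [TopologicalSpace α] {a : α} (ρ : ℂ)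

lemma continuousAt_rowSum {f : α → ℂ} (hf : ContinuousAt f a) {fs : List (α → ℂ)}
    (hfs : ∀ g ∈ fs, ContinuousAt g a) (h : Bool) (vs : List Bool) {Ψ : α → List Bool → ℂ}
    (hΨ : ∀ w, ContinuousAt (fun t => Ψ t w) a) :
    ContinuousAt (fun t => rowSum ρ (f t) (fs.map fun g => g t) h vs (Ψ t)) a := by
  induction fs generalizing h vs Ψ with
  | nil => cases h <;> simp [hΨ, continuousAt_const]
  | cons g fs ih =>
    rcases vs with _ | ⟨v, vs⟩
    · simpa using continuousAt_const
    have hg := hfs g (by simp)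
    have IH := fun k b => ih (fun g hg => hfs g (by simp [hg])) k vs
      (Ψ := fun t w => Ψ t (b :: w)) (fun w => hΨ _)
    have hA : ContinuousAt (fun t => weightA ρ (f t * g t)) a := by unfold weightA; fun_prop
    have hB : ContinuousAt (fun t => weightB ρ (f t * g t)) a := by unfold weightB; fun_prop
    cases h <;> cases v <;> simp only [List.map_cons, rowSum_false_false, rowSum_false_true,
      rowSum_true_true, rowSum_true_false]
    · exact (hA.mul (IH _ _)).add ((hf.mul hg).mul (IH _ _))
    · exact hB.mul (IH _ _)
    · exact hB.mul (IH _ _)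
    · exact (hA.mul (IH _ _)).add (IH _ _)

lemma continuousAt_evenSum {fs : List (α → ℂ)} (hfs : ∀ g ∈ fs, ContinuousAt g a)
    (vs : List Bool) : ContinuousAt (fun t => evenSum ρ (fs.map fun g => g t) vs) a := by
  induction fs generalizing vs with
  | nil => simpa [evenSum] using continuousAt_const
  | cons f fs ih =>
    rcases vs with _ | ⟨v, vs⟩
    · simpa [evenSum] using continuousAt_const
    · exact continuousAt_rowSum ρ (hfs f (by simp)) (fun g hg => hfs g (by simp [hg])) v vs
        (ih fun g hg => hfs g (by simp [hg]))

lemma continuousAt_oddSum {fs : List (α → ℂ)} (hfs : ∀ g ∈ fs, ContinuousAt g a)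
    (hne : ∀ g ∈ fs, ρ * g a - 1 ≠ 0) (vs : List Bool) :
    ContinuousAt (fun t => oddSum ρ (fs.map fun g => g t) vs) a := by
  induction fs generalizing vs with
  | nil => simpa [oddSum] using continuousAt_const
  | cons f fs ih =>
    rcases vs with _ | ⟨v, vs⟩
    · simpa [oddSum] using continuousAt_const
    have hf := hfs f (by simp)
    have hfs' : ∀ g ∈ fs, ContinuousAt g a := fun g hg => hfs g (by simp [hg])
    have hF : ContinuousAt (fun t => weightF ρ v (f t)) a := by
      have := hne f (by simp)
      unfold weightF
      cases v
      · simp only [Bool.false_eq_true, if_false]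
        exact ContinuousAt.div₀ (by fun_prop) (by fun_prop) this
      · simp only [if_true]
        exact ContinuousAt.div₀ (by fun_prop) (by fun_prop) this
    exact (continuousAt_rowSum ρ hf hfs' v vs
      (ih hfs' fun g hg => hne g (by simp [hg]))).add
      (hF.mul (continuousAt_rowSum ρ hf hfs' _ vs (continuousAt_evenSum ρ hfs')))

end continuity

section ones

open Filter Topology

/-- A family of lists of distinct positive parameters tending to a list of ones. -/
noncomputable def nearOnes (N : ℕ) : List (ℝ → ℂ) := (List.range N).map fun (j : ℕ) t => 1 + j * t

lemma nearOnes_zero (N : ℕ) : ((nearOnes N).map fun g => g 0) = List.replicate N 1 := by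
  simp [nearOnes, Function.comp_def, List.map_const']

lemma continuousAt_of_mem_nearOnes {N : ℕ} {g : ℝ → ℂ} (hg : g ∈ nearOnes N) :
    ContinuousAt g 0 := by
  obtain ⟨j, -, rfl⟩ := List.mem_map.1 hg
  have := Complex.continuous_ofReal
  fun_prop

lemma apply_of_mem_nearOnes {N : ℕ} {g : ℝ → ℂ} (hg : g ∈ nearOnes N) : g 0 = 1 := by
  obtain ⟨j, -, rfl⟩ := List.mem_map.1 hg
  simp

lemma eq_zero_at_ones {N : ℕ} {F : List ℂ → ℂ}
    (hF : ContinuousAt (fun t => F ((nearOnes N).map fun g => g t)) 0)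
    (h : ∀ xs : List ℂ, xs.length = N → xs.Nodup → (∀ x ∈ xs, PosReal x) → F xs = 0) :
    F (List.replicate N 1) = 0 := by
  rw [← nearOnes_zero]
  refine tendsto_nhds_unique (f := fun t => F ((nearOnes N).map fun g => g t)) (l := 𝓝[>] (0 : ℝ))
    (hF.tendsto.mono_left nhdsWithin_le_nhds) (tendsto_const_nhds.congr' ?_)
  filter_upwards [self_mem_nhdsWithin] with t ht
  have ht : 0 < t := ht
  refine (h _ (by simp [nearOnes]) ?_ ?_).symm
  · rw [nearOnes, List.map_map]
    refine List.Nodup.map (fun i j hij => ?_) List.nodup_range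
    have : (i : ℂ) * t = j * t := by simpa using hij
    have := mul_right_cancel₀ (by exact_mod_cast ht.ne') this
    exact_mod_cast this
  · intro x hx
    simp only [nearOnes, List.map_map, List.mem_map] at hx
    obtain ⟨j, -, rfl⟩ := hx
    refine ⟨by simp, ?_⟩
    simp
    positivity

variable {ρ : ℂ} (hρ : ρ ^ 2 = ρ - 1)
include hρ

lemma evenZ_ones_sum_root_mul (n : ℕ) {h : ℂ → ℂ}
    (hh : ∀ Y, h Y = evenZ ρ (Y :: List.replicate (2 * n + 1) 1) *
      ((Y ^ 2 - 1) * ((Y - 1) * (Y - 1)) ^ (2 * n + 1))) (Y : ℂ) :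
    h Y + h (ρ ^ 2 * Y) + h ((ρ ^ 2) ^ 2 * Y) = 0 := by
  obtain ⟨k, hk'⟩ : ∃ k : List ℂ → ℂ → ℂ, ∀ xs Y, k xs Y = evenZ ρ (Y :: xs) *
    ((Y ^ 2 - 1) * (xs.map fun x => (Y - x) * (Y * x - 1)).prod) := ⟨_, fun _ _ => rfl⟩
  have hk : ∀ Y, ContinuousAt (fun t => k ((nearOnes (2 * n + 1)).map fun g => g t) Y) 0 := by
    intro Y
    simp only [hk']
    refine ContinuousAt.mul ?_ (continuousAt_const.mul ?_)
    · have := continuousAt_evenSum (a := (0 : ℝ)) ρ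
        (fs := (fun _ => Y) :: nearOnes (2 * n + 1)) (fun g hg => ?_)
        (List.replicate (2 * n + 1 + 1) false)
      · simpa [evenZ, nearOnes] using this
      · rcases List.mem_cons.1 hg with rfl | hg
        · exact continuousAt_const
        · exact continuousAt_of_mem_nearOnes hg
    · simp only [List.map_map]
      refine tendsto_list_prod (f := fun (g : ℝ → ℂ) t => (Y - g t) * (Y * g t - 1)) _ fun g hg => ?_
      have := continuousAt_of_mem_nearOnes hg
      exact ContinuousAt.tendsto (f := fun t => (Y - g t) * (Y * g t - 1)) (by fun_prop)
  have := eq_zero_at_ones (F := fun xs => k xs Y + k xs (ρ ^ 2 * Y) + k xs ((ρ ^ 2) ^ 2 * Y))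
    (((hk _).add (hk _)).add (hk _)) fun xs h1 h2 h3 =>
      evenZ_sum_root_mul hρ h1 h2 h3 (h := k xs) (hk' xs) Y
  rw [hh, hh, hh]
  simpa only [hk', List.map_replicate, List.prod_replicate, mul_one] using this

lemma oddZ_ones (n : ℕ) :
    oddZ ρ (List.replicate (2 * n + 1) 1) + oddZ (1 - ρ) (List.replicate (2 * n + 1) 1) =
      -(-3) ^ n * 2 ^ (2 * n + 1) * evenZ ρ (-1 :: List.replicate (2 * n + 1) 1) := by
  have hc := fun ρ' (h : ρ' ≠ 1) => continuousAt_oddSum (a := (0 : ℝ)) ρ'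
    (fun g hg => continuousAt_of_mem_nearOnes (N := 2 * n + 1) hg)
    (fun g hg => by rwa [apply_of_mem_nearOnes hg, mul_one, sub_ne_zero])
    (List.replicate (2 * n + 1) false)
  have h1 : ρ ≠ 1 := by rintro rfl; norm_num at hρ
  have h2 : 1 - ρ ≠ 1 := by simpa using root_ne_zero hρ
  have key := eq_zero_at_ones (N := 2 * n + 1) (F := fun xs => oddZ ρ xs + oddZ (1 - ρ) xs -
    -(-3) ^ n * (xs.map fun x => (x + 1) / (x ^ 2 - x + 1)).prod * evenZ ρ (xs ++ [-1])) ?_ ?_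
  · have hp := evenZ_perm (l := List.replicate (2 * n + 1) 1 ++ [-1]) hρ
      (List.perm_append_singleton _ _) (by
        intro x hx
        simp at hx
        rcases hx with rfl | rfl <;> simp) []
    simp only [List.nil_append] at hp
    simp only [hp] at key
    rw [sub_eq_zero] at key
    rw [key]
    norm_num
  · refine ((by simpa [oddZ, nearOnes] using hc _ h1 : ContinuousAt _ _).add
      (by simpa [oddZ, nearOnes] using hc _ h2)).sub ((continuousAt_const.mul ?_).mul ?_)
    · simp only [List.map_map]
      refine tendsto_list_prod (f := fun (g : ℝ → ℂ) t => (g t + 1) / (g t ^ 2 - g t + 1)) _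
        fun g hg => ?_
      have := continuousAt_of_mem_nearOnes hg
      refine ContinuousAt.tendsto (f := fun t => (g t + 1) / (g t ^ 2 - g t + 1))
        (ContinuousAt.div₀ (by fun_prop) (by fun_prop) ?_)
      rw [apply_of_mem_nearOnes hg]
      norm_num
    · have := continuousAt_evenSum (a := (0 : ℝ)) ρ
        (fs := nearOnes (2 * n + 1) ++ [fun _ => -1]) (fun g hg => ?_)
        (List.replicate (2 * n + 1 + 1) false)
      · simpa [evenZ, nearOnes] using this
      · rcases List.mem_append.1 hg with hg | hg
        · exact continuousAt_of_mem_nearOnes hg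
        · rw [List.mem_singleton.1 hg]
          exact continuousAt_const
  · intro xs h1 h2 h3
    rw [sub_eq_zero]
    exact oddZ_add_oddZ_conj hρ n h1 h2 h3

end ones

section sums

/-- The reciprocal of `y (y + 1) ⋯ (y + k)`. -/
noncomputable def invRising (k : ℕ) (y : ℂ) : ℂ := (∏ i ∈ range (k + 1), (y + i))⁻¹

lemma mul_invRising_succ {k : ℕ} {y : ℂ} (hy : ∀ i : ℕ, y + i ≠ 0) :
    (k + 1) * invRising (k + 1) y = invRising k y - invRising k (y + 1) := by
  have h1 : ∏ i ∈ range k, (y + 1 + i) ≠ 0 := prod_ne_zero_iff.2 fun i _ => by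
    have := hy (i + 1); push_cast at this; rwa [add_assoc, add_comm (1 : ℂ)]
  have h2 : y ≠ 0 := by simpa using hy 0
  have h3 := hy (k + 1)
  have e1 : ∏ i ∈ range (k + 1), (y + (i : ℂ)) = (∏ i ∈ range k, (y + 1 + i)) * y := by
    rw [prod_range_succ']; simp only [Nat.cast_add, Nat.cast_one, Nat.cast_zero, add_zero]
    congr 1; exact prod_congr rfl fun i _ => by ring
  have e2 : ∏ i ∈ range (k + 1), (y + 1 + (i : ℂ)) =
      (∏ i ∈ range k, (y + 1 + i)) * (y + (k + 1 : ℕ)) := by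
    rw [prod_range_succ]; push_cast; ring
  rw [invRising, invRising, invRising, prod_range_succ, e1, e2]
  have h3' : (y + (k + 1 : ℕ) : ℂ) = y + k + 1 := by push_cast; ring
  rw [h3'] at h3 ⊢
  field_simp
  ring

lemma mul_invRising_succ' {k : ℕ} {y : ℂ} (hy : y ≠ 0) :
    y * invRising (k + 1) y = invRising k (y + 1) := by
  rw [invRising, invRising, prod_range_succ']
  simp only [Nat.cast_add, Nat.cast_one, Nat.cast_zero, add_zero]
  rw [mul_inv, mul_left_comm, mul_inv_cancel₀ hy, mul_one]
  congr 1
  exact prod_congr rfl fun i _ => by ring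

lemma sum_choose_succ_mul' (m : ℕ) (g : ℕ → ℂ) :
    ∑ j ∈ range (m + 2), ((m + 1).choose j : ℂ) * g j =
      ∑ j ∈ range (m + 1), (m.choose j : ℂ) * (g j + g (j + 1)) := by
  rw [sum_choose_succ_mul (fun i _ => g i) m, add_comm, ← sum_add_distrib]
  exact sum_congr rfl fun j _ => by ring

lemma sum_choose_mul_self (m : ℕ) (g : ℕ → ℂ) :
    ∑ j ∈ range (m + 2), ((m + 1).choose j : ℂ) * (j * g j) =
      (m + 1) * ∑ j ∈ range (m + 1), (m.choose j : ℂ) * g (j + 1) := by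
  rw [sum_range_succ', mul_sum]
  simp only [Nat.cast_zero, zero_mul, mul_zero, add_zero]
  refine sum_congr rfl fun j _ => ?_
  have : ((m + 1).choose (j + 1) : ℂ) * (j + 1 : ℕ) = (m + 1 : ℕ) * m.choose j := by
    exact_mod_cast (Nat.add_one_mul_choose_eq m j).symm
  rw [← mul_assoc, this]
  push_cast
  ring

variable {y : ℂ} (hy : ∀ i : ℕ, y + i ≠ 0)
include hy

lemma add_natCast_add_ne_zero (j : ℕ) : ∀ i : ℕ, y + j + i ≠ 0 := fun i => by
  rw [add_assoc]; exact_mod_cast hy (j + i)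

lemma alternating_sum_invRising (k m : ℕ) :
    ∑ j ∈ range (m + 1), (m.choose j : ℂ) * ((-1) ^ j * invRising k (y + j)) =
      ((k + m).factorial : ℂ) / k.factorial * invRising (k + m) y := by
  induction m generalizing k with
  | zero => simp [div_self, Nat.factorial_ne_zero]
  | succ m ih =>
    rw [sum_choose_succ_mul']
    have e : ∀ j ∈ range (m + 1), (m.choose j : ℂ) * ((-1) ^ j * invRising k (y + j) +
        (-1) ^ (j + 1) * invRising k (y + (j + 1 : ℕ))) =
        (k + 1) * ((m.choose j : ℂ) * ((-1) ^ j * invRising (k + 1) (y + j))) := by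
      intro j _
      have := mul_invRising_succ (k := k) (add_natCast_add_ne_zero hy j)
      rw [show (y + (j + 1 : ℕ) : ℂ) = y + j + 1 by push_cast; ring]
      linear_combination -(m.choose j : ℂ) * (-1) ^ j * this
    rw [sum_congr rfl e, ← mul_sum, ih, show k + 1 + m = k + (m + 1) by ring, Nat.factorial_succ k]
    have := Nat.cast_ne_zero (R := ℂ).2 (Nat.factorial_ne_zero k)
    have : (k : ℂ) + 1 ≠ 0 := by exact_mod_cast Nat.succ_ne_zero k
    push_cast
    field_simp

lemma sum_choose_mul_invRising (m : ℕ) :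
    ∑ j ∈ range (m + 1), (m.choose j : ℂ) * invRising m (y + j) =
      2 ^ m * (∏ i ∈ range (m + 1), (y + 2 * i))⁻¹ := by
  induction m generalizing y with
  | zero => simp [invRising]
  | succ m ih =>
    have hy2 : ∀ i : ℕ, y + 2 + i ≠ 0 := by simpa using add_natCast_add_ne_zero hy 2
    have hm : (m : ℂ) + 1 ≠ 0 := by exact_mod_cast Nat.succ_ne_zero m
    apply mul_left_cancel₀ hm
    have e : ∀ j ∈ range (m + 1), ((m : ℂ) + 1) * ((m.choose j : ℂ) * (invRising (m + 1) (y + j) +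
        invRising (m + 1) (y + (j + 1 : ℕ)))) =
        (m.choose j : ℂ) * invRising m (y + j) - (m.choose j : ℂ) * invRising m (y + 2 + j) := by
      intro j _
      have h1 := mul_invRising_succ (k := m) (add_natCast_add_ne_zero hy j)
      have h2 := mul_invRising_succ (k := m) (add_natCast_add_ne_zero hy (j + 1))
      rw [show (y + (j + 1 : ℕ) : ℂ) = y + j + 1 by push_cast; ring] at h2 ⊢
      rw [show y + 2 + j = y + j + 1 + 1 by ring]
      linear_combination (m.choose j : ℂ) * (h1 + h2)
    rw [sum_choose_succ_mul', mul_sum, sum_congr rfl e, sum_sub_distrib, ih hy, ih hy2]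
    have hne : ∀ i : ℕ, y + 2 * i ≠ 0 := fun i => by exact_mod_cast hy (2 * i)
    have h0 : y ≠ 0 := by simpa using hy 0
    have h1 : ∏ i ∈ range m, (y + 2 + 2 * (i : ℂ)) ≠ 0 := prod_ne_zero_iff.2 fun i _ => by
      have := hne (i + 1); push_cast at this; rwa [add_assoc, ← mul_one_add, add_comm (1 : ℂ)]
    have h3 := hne (m + 1)
    have e1 : ∏ i ∈ range (m + 1), (y + 2 * (i : ℂ)) =
        (∏ i ∈ range m, (y + 2 + 2 * (i : ℂ))) * y := by
      rw [prod_range_succ']; simp only [Nat.cast_add, Nat.cast_one, Nat.cast_zero, mul_zero, add_zero]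
      congr 1; exact prod_congr rfl fun i _ => by ring
    have e2 : ∏ i ∈ range (m + 1), (y + 2 + 2 * (i : ℂ)) =
        (∏ i ∈ range m, (y + 2 + 2 * (i : ℂ))) * (y + 2 * (m + 1)) := by
      rw [prod_range_succ]; ring
    push_cast at h3
    rw [prod_range_succ _ (m + 1), e1, e2]
    push_cast
    field_simp
    ring

lemma sum_choose_mul_add_two_mul_invRising (m : ℕ) :
    ∑ j ∈ range (m + 2), ((m + 1).choose j : ℂ) * ((y + 2 * j) * invRising (m + 1) (y + j)) =
      2 ^ (m + 1) * (∏ i ∈ range (m + 1), (y + 1 + 2 * i))⁻¹ := by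
  have hy1 : ∀ i : ℕ, y + 1 + i ≠ 0 := by simpa using add_natCast_add_ne_zero hy 1
  have e : ∀ j ∈ range (m + 2), ((m + 1).choose j : ℂ) *
      ((y + 2 * j) * invRising (m + 1) (y + j)) =
      ((m + 1).choose j : ℂ) * invRising m (y + 1 + j) +
        ((m + 1).choose j : ℂ) * (j * invRising (m + 1) (y + j)) := by
    intro j _
    have := mul_invRising_succ' (k := m) (hy j)
    rw [show y + 1 + j = y + j + 1 by ring]
    linear_combination ((m + 1).choose j : ℂ) * this
  rw [sum_congr rfl e, sum_add_distrib, sum_choose_succ_mul' m fun j => invRising m (y + 1 + j),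
    sum_choose_mul_self m fun j => invRising (m + 1) (y + j), mul_sum, ← sum_add_distrib]
  have e' : ∀ j ∈ range (m + 1), (m.choose j : ℂ) * (invRising m (y + 1 + j) +
      invRising m (y + 1 + (j + 1 : ℕ))) + (m + 1) * ((m.choose j : ℂ) *
        invRising (m + 1) (y + (j + 1 : ℕ))) = 2 * (m.choose j * invRising m (y + 1 + j)) := by
    intro j _
    have := mul_invRising_succ (k := m) (add_natCast_add_ne_zero hy1 j)
    rw [show (y + 1 + (j + 1 : ℕ) : ℂ) = y + 1 + j + 1 by push_cast; ring,
      show (y + (j + 1 : ℕ) : ℂ) = y + 1 + j by push_cast; ring]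
    linear_combination (m.choose j : ℂ) * this
  rw [sum_congr rfl e', ← mul_sum, sum_choose_mul_invRising hy1, pow_succ]
  ring

end sums

section pairing

open Polynomial

lemma sum_X_sub_one_mul (q : ℂ[X]) (g : ℂ → ℂ) :
    ((X - 1) * q).sum (fun m c => c * g m) = q.sum fun m c => c * fwdDiff 1 g m := by
  have hd : ((X - 1) * q).natDegree < q.natDegree + 1 + 1 := by
    have : (X - 1 : ℂ[X]).natDegree ≤ 1 := by compute_degree
    have := natDegree_mul_le_of_le this (le_refl q.natDegree)
    omega
  rw [sum_over_range' (f := fun m c => c * g m) _ (fun m => zero_mul _) _ hd,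
    sum_over_range' (f := fun m c => c * fwdDiff 1 g m) q (fun m => zero_mul _) _
    (Nat.lt_succ_self _)]
  have e : ∀ m, ((X - 1) * q).coeff m = (X * q).coeff m - q.coeff m := fun m => by
    rw [sub_mul, one_mul, coeff_sub]
  have h1 : ∑ m ∈ range (q.natDegree + 1 + 1), (X * q).coeff m * g m =
      ∑ m ∈ range (q.natDegree + 1), q.coeff m * g (m + 1) := by
    rw [sum_range_succ']
    simp [coeff_X_mul]
  have h2 : ∑ m ∈ range (q.natDegree + 1 + 1), q.coeff m * g m =
      ∑ m ∈ range (q.natDegree + 1), q.coeff m * g m := by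
    rw [sum_range_succ, coeff_eq_zero_of_natDegree_lt (Nat.lt_succ_self _), zero_mul, add_zero]
  rw [sum_congr rfl fun (m : ℕ) _ => show ((X - 1) * q).coeff m * g m =
    (X * q).coeff m * g m - q.coeff m * g m by rw [e, sub_mul], sum_sub_distrib, h1, h2,
    ← sum_sub_distrib]
  exact sum_congr rfl fun m _ => by rw [fwdDiff, mul_sub]

lemma sum_X_sub_one_pow_mul (d : ℕ) (q : ℂ[X]) (g : ℂ → ℂ) :
    ((X - 1) ^ d * q).sum (fun m c => c * g m) =
      q.sum fun m c => c * (fwdDiff 1)^[d] g m := by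
  induction d generalizing g with
  | zero => simp
  | succ d ih => rw [pow_succ', mul_assoc, sum_X_sub_one_mul, ih, Function.iterate_succ_apply]

lemma sum_X_sub_one_pow_mul_of_monic {d : ℕ} (q : ℂ[X]) {P : ℂ[X]} (hP : P.Monic)
    (hd : P.natDegree = d) :
    ((X - 1) ^ d * q).sum (fun m c => c * P.eval (m : ℂ)) = d.factorial * q.eval 1 := by
  have := fwdDiff_iter_degree_eq_factorial P
  rw [hd, hP.leadingCoeff, one_smul] at this
  rw [sum_X_sub_one_pow_mul d q fun x => P.eval x, this, eval_eq_sum, Polynomial.sum,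
    Polynomial.sum, mul_sum]
  refine sum_congr rfl fun m _ => ?_
  simp [mul_comm]

end pairing

lemma prod_range_mul_sub (c : ℂ) (j : ℕ) :
    ∏ l ∈ range j, (c * j - c * l) = c ^ j * j.factorial := by
  induction j with
  | zero => simp
  | succ j ih =>
    rw [prod_range_succ', Nat.factorial_succ]
    have : ∏ l ∈ range j, (c * (j + 1 : ℕ) - c * (l + 1 : ℕ)) = c ^ j * j.factorial := by
      rw [← ih]
      exact prod_congr rfl fun l _ => by push_cast; ring
    rw [this]
    push_cast
    ring

lemma prod_range_mul_add_one (c : ℂ) (k : ℕ) :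
    ∏ l ∈ range k, (c * (l + 1)) = c ^ k * k.factorial := by
  induction k with
  | zero => simp
  | succ k ih =>
    rw [prod_range_succ, ih, Nat.factorial_succ]
    push_cast
    ring

section coefficients

open Polynomial

variable {M : ℕ} {p q : ℂ[X]} (hpq : p = (X - 1) ^ (2 * M + 1) * q)
  (hdeg : p.natDegree < 3 * (M + 1)) (hcoeff : ∀ j, p.coeff (3 * j + 2) = 0)
include hpq hdeg hcoeff

lemma sum_coeff_mul_eval {P : ℂ[X]} (hP : P.Monic) (hd : P.natDegree = 2 * M + 1) :
    ∑ j ∈ range (M + 1), (p.coeff (3 * j) * P.eval (3 * j : ℂ) +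
      p.coeff (3 * j + 1) * P.eval (3 * j + 1 : ℂ)) = (2 * M + 1).factorial * q.eval 1 := by
  rw [← sum_X_sub_one_pow_mul_of_monic q hP hd, ← hpq,
    sum_over_range' (f := fun m c => c * P.eval (m : ℂ)) _ (fun m => zero_mul _) _ hdeg,
    sum_range_three_mul]
  refine sum_congr rfl fun j _ => ?_
  rw [hcoeff]
  push_cast
  ring

lemma coeff_three_mul {j k : ℕ} (hjk : j + k = M) :
    p.coeff (3 * j) * ((3 ^ j * j.factorial) * ((-3) ^ k * k.factorial) *
      ∏ l ∈ range (M + 1), (3 * j - (3 * l + 1) : ℂ)) = (2 * M + 1).factorial * q.eval 1 := by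
  let P : ℂ[X] := (∏ l ∈ range j, (X - C (3 * l : ℂ))) *
    (∏ l ∈ range k, (X - C (3 * (j + 1 + l) : ℂ))) * ∏ l ∈ range (M + 1), (X - C (3 * l + 1 : ℂ))
  have h1 := monic_prod_X_sub_C (fun l : ℕ => (3 * l : ℂ)) (range j)
  have h2 := monic_prod_X_sub_C (fun l : ℕ => (3 * (j + 1 + l) : ℂ)) (range k)
  have h3 := monic_prod_X_sub_C (fun l : ℕ => (3 * l + 1 : ℂ)) (range (M + 1))
  have hP : P.Monic := (h1.mul h2).mul h3
  have hd : P.natDegree = 2 * M + 1 := by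
    rw [(h1.mul h2).natDegree_mul h3, h1.natDegree_mul h2,
      natDegree_finsetProd_X_sub_C_eq_card, natDegree_finsetProd_X_sub_C_eq_card,
      natDegree_finsetProd_X_sub_C_eq_card, card_range, card_range, card_range]
    omega
  rw [← sum_coeff_mul_eval hpq hdeg hcoeff hP hd]
  have hev : ∀ x, P.eval x = (∏ l ∈ range j, (x - 3 * l)) * (∏ l ∈ range k, (x - 3 * (j + 1 + l))) *
      ∏ l ∈ range (M + 1), (x - (3 * l + 1)) := fun x => by
    simp [P, eval_prod]
  have hz : ∀ i ∈ range (M + 1), P.eval (3 * i + 1 : ℂ) = 0 := fun i hi => by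
    rw [hev, prod_eq_zero hi (sub_self _), mul_zero]
  rw [sum_eq_single j]
  · rw [hz j (mem_range.2 (by omega)), mul_zero, add_zero, hev, prod_range_mul_sub,
      ← prod_range_mul_add_one (-3)]
    congr 3
    exact prod_congr rfl fun l _ => by ring
  · intro i hi hij
    rw [hz i hi, mul_zero, add_zero, hev]
    rcases lt_or_gt_of_ne hij with h | h
    · rw [prod_eq_zero (mem_range.2 h) (sub_self _), zero_mul, zero_mul, mul_zero]
    · obtain ⟨l, rfl⟩ := Nat.exists_eq_add_of_lt h
      rw [prod_eq_zero (i := l) (s := range k) (mem_range.2 (by have := mem_range.1 hi; omega))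
        (by push_cast; ring), mul_zero, zero_mul, mul_zero]
  · intro h
    exact absurd (mem_range.2 (by omega)) h

lemma coeff_three_mul_add_one {j k : ℕ} (hjk : j + k = M) :
    p.coeff (3 * k + 1) * ((3 ^ k * k.factorial) * ((-3) ^ j * j.factorial) *
      ∏ l ∈ range (M + 1), (3 * k + 1 - 3 * l : ℂ)) = (2 * M + 1).factorial * q.eval 1 := by
  let P : ℂ[X] := (∏ l ∈ range k, (X - C (3 * l + 1 : ℂ))) *
    (∏ l ∈ range j, (X - C (3 * (k + 1 + l) + 1 : ℂ))) * ∏ l ∈ range (M + 1), (X - C (3 * l : ℂ))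
  have h1 := monic_prod_X_sub_C (fun l : ℕ => (3 * l + 1 : ℂ)) (range k)
  have h2 := monic_prod_X_sub_C (fun l : ℕ => (3 * (k + 1 + l) + 1 : ℂ)) (range j)
  have h3 := monic_prod_X_sub_C (fun l : ℕ => (3 * l : ℂ)) (range (M + 1))
  have hP : P.Monic := (h1.mul h2).mul h3
  have hd : P.natDegree = 2 * M + 1 := by
    rw [(h1.mul h2).natDegree_mul h3, h1.natDegree_mul h2,
      natDegree_finsetProd_X_sub_C_eq_card, natDegree_finsetProd_X_sub_C_eq_card,
      natDegree_finsetProd_X_sub_C_eq_card, card_range, card_range, card_range]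
    omega
  rw [← sum_coeff_mul_eval hpq hdeg hcoeff hP hd]
  have hev : ∀ x, P.eval x = (∏ l ∈ range k, (x - (3 * l + 1))) *
      (∏ l ∈ range j, (x - (3 * (k + 1 + l) + 1))) * ∏ l ∈ range (M + 1), (x - 3 * l) := fun x => by
    simp [P, eval_prod]
  have hz : ∀ i ∈ range (M + 1), P.eval (3 * i : ℂ) = 0 := fun i hi => by
    rw [hev, prod_eq_zero hi (sub_self _), mul_zero]
  rw [sum_eq_single k]
  · rw [hz k (mem_range.2 (by omega)), mul_zero, zero_add, hev, ← prod_range_mul_sub,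
      ← prod_range_mul_add_one (-3)]
    congr 3
    · exact prod_congr rfl fun l _ => by ring
    · exact prod_congr rfl fun l _ => by ring
  · intro i hi hij
    rw [hz i hi, mul_zero, zero_add, hev]
    rcases lt_or_gt_of_ne hij with h | h
    · rw [prod_eq_zero (mem_range.2 h) (sub_self _), zero_mul, zero_mul, mul_zero]
    · obtain ⟨l, rfl⟩ := Nat.exists_eq_add_of_lt h
      rw [prod_eq_zero (i := l) (s := range j) (mem_range.2 (by have := mem_range.1 hi; omega))
        (by push_cast; ring), mul_zero, zero_mul, mul_zero]
  · intro h
    exact absurd (mem_range.2 (by omega)) h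

omit hpq hdeg hcoeff in
lemma neg_sub_third_add_ne_zero (i : ℕ) : (-M - 1 / 3 : ℂ) + i ≠ 0 := by
  intro h
  have h' : (3 * i : ℂ) = 3 * M + 1 := by linear_combination 3 * h
  have : 3 * i = 3 * M + 1 := by exact_mod_cast h'
  omega

omit hpq hdeg hcoeff in
lemma prod_range_sub_eq {j : ℕ} :
    ∏ l ∈ range (M + 1), (3 * j - (3 * l + 1) : ℂ) =
      3 ^ (M + 1) * (invRising M (-M - 1 / 3 + j))⁻¹ := by
  have h3 : (3 : ℂ) ^ (M + 1) = ∏ _l ∈ range (M + 1), 3 := by simp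
  rw [invRising, inv_inv, ← prod_range_reflect, h3, ← prod_mul_distrib]
  refine prod_congr rfl fun l hl => ?_
  have := mem_range.1 hl
  rw [show M + 1 - 1 - l = M - l by omega, Nat.cast_sub (by omega)]
  ring

lemma coeff_three_mul_eq (hM : Odd M) {j : ℕ} (hj : j ≤ M) :
    p.coeff (3 * j) = -((2 * M + 1).factorial * q.eval 1 / (3 ^ (2 * M + 1) * M.factorial)) *
      (M.choose j * ((-1) ^ j * invRising M (-M - 1 / 3 + j))) := by
  obtain ⟨k, rfl⟩ := Nat.exists_eq_add_of_le hj
  have h := coeff_three_mul hpq hdeg hcoeff (rfl : j + k = j + k)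
  have hne : invRising (j + k) (-(j + k : ℕ) - 1 / 3 + j) ≠ 0 :=
    inv_ne_zero (prod_ne_zero_iff.2 fun i _ =>
      add_natCast_add_ne_zero neg_sub_third_add_ne_zero j i)
  have hc : ((j + k).choose j : ℂ) * (j.factorial * k.factorial) = (j + k).factorial := by
    have := Nat.choose_mul_factorial_mul_factorial (Nat.le_add_right j k)
    rw [add_tsub_cancel_left] at this
    rw [← mul_assoc]
    exact_mod_cast this
  have hs : (-1 : ℂ) ^ k = -(-1) ^ j := by
    rcases Nat.even_or_odd j with h | h
    · rw [h.neg_one_pow, ((Nat.odd_add'.1 hM).2 h).neg_one_pow]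
    · rw [h.neg_one_pow, ((Nat.odd_add.1 hM).1 h).neg_one_pow]; simp
  have hj0 := Nat.cast_ne_zero (R := ℂ).2 (Nat.factorial_ne_zero j)
  have hk0 := Nat.cast_ne_zero (R := ℂ).2 (Nat.factorial_ne_zero k)
  have hc0 : ((j + k).choose j : ℂ) ≠ 0 := by
    exact_mod_cast (Nat.choose_pos (Nat.le_add_right j k)).ne'
  have h1 : ((-1 : ℂ) ^ j) ^ 2 = 1 := by rw [← pow_mul, mul_comm, pow_mul]; simp
  rw [prod_range_sub_eq] at h
  rw [← h, ← hc, show (-3 : ℂ) ^ k = -(-1) ^ j * 3 ^ k by rw [← hs, ← mul_pow]; norm_num,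
    show 2 * (j + k) + 1 = j + k + (j + k + 1) by ring, pow_add 3 (j + k), pow_add 3 j k]
  generalize invRising (j + k) (-(j + k : ℕ) - 1 / 3 + j) = I at *
  field_simp
  linear_combination (-p.coeff (3 * j) * 3 ^ (j * 2) * 3 ^ (k * 2) * 3) * h1

lemma coeff_three_mul_add_one_eq (hM : Odd M) {j : ℕ} (hj : j ≤ M) :
    p.coeff (3 * (M - j) + 1) = -p.coeff (3 * j) := by
  obtain ⟨k, rfl⟩ := Nat.exists_eq_add_of_le hj
  have h := coeff_three_mul hpq hdeg hcoeff (rfl : j + k = j + k)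
  have h' := coeff_three_mul_add_one hpq hdeg hcoeff (rfl : j + k = j + k)
  have e : ∏ l ∈ range (j + k + 1), (3 * k + 1 - 3 * l : ℂ) =
      ∏ l ∈ range (j + k + 1), (3 * j - (3 * l + 1) : ℂ) := by
    rw [← prod_range_reflect]
    have : ∀ l ∈ range (j + k + 1), (3 * k + 1 - 3 * (j + k + 1 - 1 - l : ℕ) : ℂ) =
        -1 * (3 * j - (3 * l + 1)) := by
      intro l hl
      have := mem_range.1 hl
      rw [show j + k + 1 - 1 - l = j + k - l by omega, Nat.cast_sub (by omega)]
      push_cast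
      ring
    rw [prod_congr rfl this, prod_mul_distrib, prod_const, card_range,
      (hM.add_one : Even (j + k + 1)).neg_one_pow, one_mul]
  have hs : (-1 : ℂ) ^ k = -(-1) ^ j := by
    rcases Nat.even_or_odd j with h | h
    · rw [h.neg_one_pow, ((Nat.odd_add'.1 hM).2 h).neg_one_pow]
    · rw [h.neg_one_pow, ((Nat.odd_add.1 hM).1 h).neg_one_pow]; simp
  have hne : ∏ l ∈ range (j + k + 1), (3 * j - (3 * l + 1) : ℂ) ≠ 0 := by
    refine prod_ne_zero_iff.2 fun l _ h0 => ?_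
    have h' : (3 * j : ℂ) = 3 * l + 1 := by linear_combination h0
    have : 3 * j = 3 * l + 1 := by exact_mod_cast h'
    omega
  have hj0 := Nat.cast_ne_zero (R := ℂ).2 (Nat.factorial_ne_zero j)
  have hk0 := Nat.cast_ne_zero (R := ℂ).2 (Nat.factorial_ne_zero k)
  rw [add_tsub_cancel_left]
  rw [e, ← h, show (-3 : ℂ) ^ k = -(-1) ^ j * 3 ^ k by rw [← hs, ← mul_pow]; norm_num,
    show (-3 : ℂ) ^ j = (-1) ^ j * 3 ^ j by rw [← mul_pow]; norm_num] at h'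
  have hne' : (3 ^ k * k.factorial) * ((-1) ^ j * 3 ^ j * j.factorial) *
      ∏ l ∈ range (j + k + 1), (3 * j - (3 * l + 1) : ℂ) ≠ 0 :=
    mul_ne_zero (mul_ne_zero (mul_ne_zero (pow_ne_zero _ (by norm_num)) hk0) (mul_ne_zero (mul_ne_zero
      (pow_ne_zero _ (by norm_num)) (pow_ne_zero _ (by norm_num))) hj0)) hne
  apply mul_right_cancel₀ hne'
  linear_combination h'

lemma sum_coeff_three_mul_add_one (hM : Odd M) (f : ℕ → ℂ) :
    ∑ j ∈ range (M + 1), p.coeff (3 * j + 1) * f j =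
      -∑ j ∈ range (M + 1), p.coeff (3 * j) * f (M - j) := by
  rw [← sum_range_reflect, ← sum_neg_distrib]
  refine sum_congr rfl fun j hj => ?_
  have hj := mem_range.1 hj
  rw [show M + 1 - 1 - j = M - j by omega,
    coeff_three_mul_add_one_eq hpq hdeg hcoeff hM (by omega)]
  ring

lemma eval_root_eq (hM : Odd M) {ω : ℂ} (hω : ω ^ 3 = 1) :
    p.eval ω = (ω - 1) * ((2 * M + 1).factorial * q.eval 1 / (3 ^ (2 * M + 1) * M.factorial)) *
      ((2 * M).factorial / M.factorial * invRising (2 * M) (-M - 1 / 3)) := by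
  have key := sum_coeff_three_mul_add_one hpq hdeg hcoeff hM fun _ => ω
  have hT := alternating_sum_invRising (y := -M - 1 / 3) (neg_sub_third_add_ne_zero (M := M)) M M
  rw [← two_mul] at hT
  have hu := fun j (hj : j ∈ range (M + 1)) =>
    coeff_three_mul_eq hpq hdeg hcoeff hM (j := j) (by have := mem_range.1 hj; omega)
  generalize ((2 * M + 1).factorial * q.eval 1 / (3 ^ (2 * M + 1) * M.factorial) : ℂ) = K at hu ⊢
  rw [eval_eq_sum_range' hdeg, sum_range_three_mul, ← hT]
  simp only [hcoeff, zero_mul, add_zero, pow_add, pow_mul, hω, one_pow, pow_one, one_mul, mul_one]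
  rw [sum_add_distrib, key, mul_sum, ← sum_neg_distrib, ← sum_add_distrib]
  refine sum_congr rfl fun j hj => ?_
  rw [hu j hj]
  ring

lemma eval_derivative_neg_one_eq (hM : Odd M) :
    p.derivative.eval (-1) =
      3 * ((2 * M + 1).factorial * q.eval 1 / (3 ^ (2 * M + 1) * M.factorial)) *
        (2 ^ M * (∏ i ∈ range M, (-M - 1 / 3 + 1 + 2 * i : ℂ))⁻¹) := by
  obtain ⟨m, rfl⟩ : ∃ m, M = m + 1 := ⟨M - 1, by have := hM.pos; omega⟩
  have hS := sum_choose_mul_add_two_mul_invRising (neg_sub_third_add_ne_zero (M := m + 1)) m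
  have key := sum_coeff_three_mul_add_one hpq hdeg hcoeff hM fun j => (-1) ^ j * (3 * j + 1)
  have e : ∀ n : ℕ, (n : ℂ) * (-1) ^ (n - 1) = -(n * (-1) ^ n) := by
    rintro (_ | n)
    · simp
    · rw [Nat.add_sub_cancel, pow_succ]; ring
  rw [derivative_eval, sum_over_range' _ (fun _ => by simp) _ hdeg, sum_range_three_mul, ← hS]
  simp only [hcoeff, zero_mul, add_zero, mul_assoc, e]
  have hk : ∀ j : ℕ, ((3 * j + 1 : ℕ) : ℂ) * (-1) ^ (3 * j + 1) = -((-1) ^ j * (3 * j + 1)) := by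
    intro j
    rw [pow_succ, pow_mul]; push_cast; norm_num; ring
  simp only [hk, mul_neg, neg_neg]
  rw [sum_add_distrib, key, mul_sum, mul_sum, ← sum_neg_distrib, ← sum_add_distrib]
  refine sum_congr rfl fun j hj => ?_
  have hj : j ≤ m + 1 := by have := mem_range.1 hj; omega
  have hs : (-1 : ℂ) ^ (m + 1 - j) = -(-1) ^ j := by
    obtain ⟨k, hk⟩ := Nat.exists_eq_add_of_le hj
    rw [hk] at hM
    rw [hk, add_tsub_cancel_left]
    rcases Nat.even_or_odd j with h | h
    · rw [h.neg_one_pow, ((Nat.odd_add'.1 hM).2 h).neg_one_pow]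
    · rw [h.neg_one_pow, ((Nat.odd_add.1 hM).1 h).neg_one_pow]; simp
  have h1 : ((-1 : ℂ) ^ j) ^ 2 = 1 := by rw [← pow_mul, mul_comm, pow_mul]; simp
  have h3 : ((-1 : ℂ)) ^ (3 * j) = (-1) ^ j := by rw [pow_mul]; norm_num
  rw [coeff_three_mul_eq hpq hdeg hcoeff hM hj, hs, h3, Nat.cast_sub hj]
  generalize ((2 * (m + 1) + 1).factorial * q.eval 1 / (3 ^ (2 * (m + 1) + 1) *
    (m + 1).factorial) : ℂ) = K
  push_cast
  generalize invRising (m + 1) (-(m + 1 : ℂ) - 1 / 3 + j) = I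
  linear_combination (K * (m + 1).choose j * I * 3 * (-(m + 1 : ℂ) - 1 / 3 + 2 * j)) * h1

end coefficients

section specialization

open Polynomial

lemma coeff_three_mul_add_two_eq_zero {p : ℂ[X]} {ω : ℂ} (hω : ω ^ 2 + ω + 1 = 0)
    (h : ∀ Y, Y * p.eval Y + ω * Y * p.eval (ω * Y) + ω ^ 2 * Y * p.eval (ω ^ 2 * Y) = 0)
    (j : ℕ) : p.coeff (3 * j + 2) = 0 := by
  have h0 : X * p + (X * p).comp (C ω * X) + (X * p).comp (C (ω ^ 2) * X) = 0 :=
    Polynomial.funext fun Y => by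
      simp only [eval_add, eval_mul, eval_comp, eval_X, eval_C, eval_zero]
      exact h Y
  have hc := congrArg (fun P => P.coeff (3 * j + 2 + 1)) h0
  simp only [coeff_add, comp_C_mul_X_coeff, coeff_X_mul, coeff_zero] at hc
  have h3 : ω ^ 3 = 1 := by linear_combination (ω - 1) * hω
  have e1 : ω ^ (3 * j + 2 + 1) = 1 := by
    rw [show 3 * j + 2 + 1 = 3 * (j + 1) by ring, pow_mul, h3, one_pow]
  rw [← pow_mul, mul_comm 2, pow_mul, e1] at hc
  linear_combination hc / 3

variable {ρ : ℂ} (hρ : ρ ^ 2 = ρ - 1)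
include hρ

lemma evenZ_root_ones (n : ℕ) : evenZ ρ (ρ ^ 2 :: List.replicate (2 * n + 1) 1) =
    ρ ^ 2 * (ρ ^ 2) ^ n * evenZ ρ (List.replicate (2 * n) 1) := by
  have hA : weightA ρ (ρ ^ 2) = ρ := by
    rw [weightA]; linear_combination (1 - ρ) / 3 * hρ
  have h1 : weightA ρ 1 = 1 := by rw [weightA]; ring
  have h := evenZ_of_weightB (ρ ^ 2) 1 (by rw [mul_one, weightB_root hρ]) (List.replicate (2 * n) 1)
  rw [List.replicate_succ', h]
  simp [hA, h1, pow_mul]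

lemma evenZ_ones_relations (n : ℕ) :
    ∃ K : ℂ, K = (4 * n + 3).factorial * (2 * evenZ ρ (List.replicate (2 * n + 2) 1)) /
        (3 ^ (4 * n + 3) * (2 * n + 1).factorial) ∧
      3 * 9 ^ n * evenZ ρ (List.replicate (2 * n) 1) = K * ((4 * n + 2).factorial /
        (2 * n + 1).factorial * invRising (4 * n + 2) (-(2 * n + 1 : ℕ) - 1 / 3)) ∧
      2 ^ (4 * n + 3) * evenZ ρ (-1 :: List.replicate (2 * n + 1) 1) = 3 * K * (2 ^ (2 * n + 1) *
        (∏ i ∈ range (2 * n + 1), (-(2 * n + 1 : ℕ) - 1 / 3 + 1 + 2 * i : ℂ))⁻¹) := by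
  obtain ⟨e, hd, he⟩ := exists_polynomial_evenZ ρ (List.replicate (2 * n + 1) 1)
  rw [List.length_replicate] at hd
  set ω := ρ ^ 2 with hω'
  have hω : ω ^ 2 + ω + 1 = 0 := by rw [hω']; linear_combination (ρ ^ 2 + ρ + 1) * hρ
  have h3 : ω ^ 3 = 1 := by linear_combination (ω - 1) * hω
  obtain ⟨p, hp⟩ : ∃ p : ℂ[X], p = (X - 1) ^ (2 * (2 * n + 1) + 1) * ((X + 1) * e) := ⟨_, rfl⟩
  have hpe : ∀ Y, p.eval Y = (Y - 1) ^ (4 * n + 3) * ((Y + 1) * e.eval Y) := fun Y => by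
    rw [hp, show 2 * (2 * n + 1) + 1 = 4 * n + 3 by ring]; simp
  have hdeg : p.natDegree < 3 * (2 * n + 1 + 1) := by
    have he' : e.natDegree ≤ 2 * n := by
      refine natDegree_le_of_degree_le (Order.lt_succ_iff.1 ?_)
      exact hd
    have h1 : ((X - 1 : ℂ[X]) ^ (2 * (2 * n + 1) + 1)).natDegree ≤ 2 * (2 * n + 1) + 1 := by
      compute_degree
    have h2 : (X + 1 : ℂ[X]).natDegree ≤ 1 := by compute_degree
    have := natDegree_mul_le_of_le h1 (natDegree_mul_le_of_le h2 he')
    rw [hp]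
    omega
  have hcoeff := coeff_three_mul_add_two_eq_zero (p := p) hω (fun Y => by
    have := evenZ_ones_sum_root_mul hρ n (h := fun Y => Y * p.eval Y) (fun Y => by
      rw [hpe, he, show 4 * n + 3 = 2 * (2 * n + 1) + 1 by ring, pow_succ, pow_mul, sq (Y - 1)]
      ring) Y
    exact this)
  have hM : Odd (2 * n + 1) := odd_two_mul_add_one n
  have hq : ((X + 1) * e).eval 1 = 2 * evenZ ρ (List.replicate (2 * n + 2) 1) := by
    rw [List.replicate_succ, he]
    simp only [eval_mul, eval_add, eval_X, eval_one, one_mul]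
    norm_num
  have H1 := eval_root_eq hp hdeg hcoeff hM h3
  have H2 := eval_derivative_neg_one_eq hp hdeg hcoeff hM
  rw [hq, show 2 * (2 * n + 1) + 1 = 4 * n + 3 by ring] at H1 H2
  rw [show 2 * (2 * n + 1) = 4 * n + 2 by ring] at H1
  refine ⟨_, rfl, ?_, ?_⟩
  · have hω1 : ω - 1 ≠ 0 := by
      intro h
      have : ω = 1 := by linear_combination h
      rw [this] at hω; norm_num at hω
    have hω0 : ω ≠ 0 := by rintro h; rw [h] at hω; norm_num at hω
    have heω : e.eval ω = ω ^ n * evenZ ρ (List.replicate (2 * n) 1) := by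
      apply mul_left_cancel₀ hω0
      rw [← he, evenZ_root_ones hρ, mul_assoc]
    apply mul_left_cancel₀ hω1
    rw [← mul_assoc (ω - 1) (_ / _), ← H1, hpe, heω,
      show 4 * n + 3 = 2 * (2 * n + 1) + 1 by ring, pow_succ, pow_mul,
      show (ω - 1) ^ 2 = -(3 * ω) by linear_combination hω, (odd_two_mul_add_one n).neg_pow, mul_pow,
      show ω + 1 = -ω ^ 2 by linear_combination hω, pow_succ 3 (2 * n), pow_mul 3,
      show ω ^ (2 * n + 1) = ω ^ n * ω ^ n * ω by ring]
    have h3n : ω ^ n * ω ^ n * ω ^ n = 1 := by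
      rw [← mul_pow, ← mul_pow, ← h3]
      ring_nf
      simp [h3, mul_comm n, pow_mul]
    norm_num
    linear_combination (-(3 * 9 ^ n * (ω - 1) * evenZ ρ (List.replicate (2 * n) 1))) *
      (ω ^ 3 * h3n + h3)
  · rw [← H2, he, hp, derivative_mul, derivative_mul]
    simp only [eval_mul, eval_add, eval_sub, eval_X, eval_one, eval_pow, derivative_add,
      derivative_X, derivative_one]
    rw [show 2 * (2 * n + 1) + 1 = 4 * n + 3 by ring, show (-1 - 1 : ℂ) = -2 by norm_num,
      (show Odd (4 * n + 3) from ⟨2 * n + 1, by ring⟩).neg_pow]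
    simp

end specialization

section closedForms

lemma prod_three_mul_eq_factorial (m : ℕ) :
    (∏ k ∈ range (m + 1), (3 * k + 1 : ℂ)) * (∏ k ∈ range m, (3 * k + 2 : ℂ)) *
      (3 ^ m * m.factorial) = (3 * m + 1).factorial := by
  induction m with
  | zero => simp
  | succ m ih =>
    rw [prod_range_succ _ (m + 1), prod_range_succ (fun k : ℕ => (3 * k + 2 : ℂ)) m,
      show 3 * (m + 1) + 1 = 3 * m + 1 + 1 + 1 + 1 by ring,
      Nat.factorial_succ (3 * m + 1 + 1 + 1), Nat.factorial_succ (3 * m + 1 + 1),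
      Nat.factorial_succ (3 * m + 1), Nat.factorial_succ m]
    push_cast
    rw [← ih]
    ring

lemma prod_rising_eq (n : ℕ) :
    ∏ i ∈ range (4 * n + 2 + 1), (-(2 * n + 1 : ℕ) - 1 / 3 + i : ℂ) =
      (6 * n + 4).factorial / (3 ^ (6 * n + 4) * (2 * n + 1).factorial) := by
  have h0 := prod_three_mul_eq_factorial (2 * n + 1)
  have h1 : ∏ i ∈ range (2 * n + 1 + 1), (-(2 * n + 1 : ℕ) - 1 / 3 + i : ℂ) =
      (∏ k ∈ range (2 * n + 1 + 1), (3 * k + 1 : ℂ)) / 3 ^ (2 * n + 2) := by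
    rw [← prod_range_reflect, eq_div_iff (by simp)]
    have h3 : (3 : ℂ) ^ (2 * n + 2) = ∏ _l ∈ range (2 * n + 1 + 1), (-3) := by
      simp [(show Even (2 * n + 1 + 1) from ⟨n + 1, by ring⟩).neg_pow]
    rw [h3, ← prod_mul_distrib]
    refine prod_congr rfl fun i hi => ?_
    have := mem_range.1 hi
    rw [show 2 * n + 1 + 1 - 1 - i = 2 * n + 1 - i by omega, Nat.cast_sub (by omega)]
    ring
  have h2 : ∏ i ∈ range (2 * n + 1), (-(2 * n + 1 : ℕ) - 1 / 3 + (2 * n + 1 + 1 + i : ℕ) : ℂ) =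
      (∏ k ∈ range (2 * n + 1), (3 * k + 2 : ℂ)) / 3 ^ (2 * n + 1) := by
    have h3 : (3 : ℂ) ^ (2 * n + 1) = ∏ _l ∈ range (2 * n + 1), 3 := by simp
    rw [eq_div_iff (by simp), h3, ← prod_mul_distrib]
    refine prod_congr rfl fun i _ => ?_
    push_cast
    ring
  have hf := Nat.cast_ne_zero (R := ℂ).2 (Nat.factorial_ne_zero (2 * n + 1))
  rw [show 4 * n + 2 + 1 = 2 * n + 1 + 1 + (2 * n + 1) by ring, prod_range_add, h1, h2,
    show 6 * n + 4 = 3 * (2 * n + 1) + 1 by ring, ← h0]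
  field_simp
  ring

lemma prod_six_mul_eq (n : ℕ) :
    (∏ k ∈ range (n + 1), (6 * k + 1 : ℂ)) * ∏ k ∈ range n, (6 * k + 5 : ℂ) =
      (6 * n + 4).factorial * n.factorial /
        (2 ^ (2 * n + 2) * 3 ^ (n + 1) * (2 * n + 1).factorial * (3 * n + 2).factorial) := by
  rw [eq_div_iff (by simp [Nat.factorial_ne_zero])]
  induction n with
  | zero => norm_num [Nat.factorial]
  | succ n ih =>
    rw [prod_range_succ _ (n + 1), prod_range_succ (fun k : ℕ => (6 * k + 5 : ℂ)) n,
      show 6 * (n + 1) + 4 = 6 * n + 4 + 1 + 1 + 1 + 1 + 1 + 1 by ring,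
      show 2 * (n + 1) + 1 = 2 * n + 1 + 1 + 1 by ring,
      show 3 * (n + 1) + 2 = 3 * n + 2 + 1 + 1 + 1 by ring]
    simp only [Nat.factorial_succ (6 * n + 4 + 1 + 1 + 1 + 1 + 1),
      Nat.factorial_succ (6 * n + 4 + 1 + 1 + 1 + 1), Nat.factorial_succ (6 * n + 4 + 1 + 1 + 1),
      Nat.factorial_succ (6 * n + 4 + 1 + 1), Nat.factorial_succ (6 * n + 4 + 1),
      Nat.factorial_succ (6 * n + 4), Nat.factorial_succ (2 * n + 1 + 1),
      Nat.factorial_succ (2 * n + 1), Nat.factorial_succ (3 * n + 2 + 1 + 1),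
      Nat.factorial_succ (3 * n + 2 + 1), Nat.factorial_succ (3 * n + 2), Nat.factorial_succ n]
    push_cast
    linear_combination ((6 * n + 10 : ℂ) * (6 * n + 9) * (6 * n + 8) * (6 * n + 7) * (6 * n + 6) *
      (6 * n + 5) * (n + 1)) * ih

lemma prod_odd_step_eq (n : ℕ) :
    ∏ i ∈ range (2 * n + 1), (-(2 * n + 1 : ℕ) - 1 / 3 + 1 + 2 * i : ℂ) =
      (-1) ^ (n + 1) * ((6 * n + 4).factorial * n.factorial /
        (2 ^ (2 * n + 2) * 3 ^ (3 * n + 2) * (2 * n + 1).factorial * (3 * n + 2).factorial)) := by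
  have h0 := prod_six_mul_eq n
  have h1 : ∏ i ∈ range (n + 1), (-(2 * n + 1 : ℕ) - 1 / 3 + 1 + 2 * i : ℂ) =
      (-1) ^ (n + 1) * (∏ k ∈ range (n + 1), (6 * k + 1 : ℂ)) / 3 ^ (n + 1) := by
    have h3 : (3 : ℂ) ^ (n + 1) = ∏ _l ∈ range (n + 1), 3 := by simp
    have h4 : (-1 : ℂ) ^ (n + 1) = ∏ _l ∈ range (n + 1), (-1) := by simp
    rw [← prod_range_reflect, eq_div_iff (by simp), h3, h4, ← prod_mul_distrib, ← prod_mul_distrib]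
    refine prod_congr rfl fun i hi => ?_
    have := mem_range.1 hi
    rw [show n + 1 - 1 - i = n - i by omega, Nat.cast_sub (by omega)]
    push_cast
    ring
  have h2 : ∏ i ∈ range n, (-(2 * n + 1 : ℕ) - 1 / 3 + 1 + 2 * (n + 1 + i : ℕ) : ℂ) =
      (∏ k ∈ range n, (6 * k + 5 : ℂ)) / 3 ^ n := by
    have h3 : (3 : ℂ) ^ n = ∏ _l ∈ range n, 3 := by simp
    rw [eq_div_iff (by simp), h3, ← prod_mul_distrib]
    refine prod_congr rfl fun i _ => ?_
    push_cast
    ring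
  rw [show 2 * n + 1 = n + 1 + n by ring, prod_range_add, ← show 2 * n + 1 = n + 1 + n by ring,
    h1, h2, div_mul_div_comm, mul_assoc, h0]
  field_simp
  ring

lemma prod_Icc_two_mul_add_one (n : ℕ) :
    ∏ i ∈ Icc 1 n, (2 * n + 2 * i + 1 : ℂ) =
      (4 * n + 2).factorial * n.factorial / (2 ^ (n + 1) * (2 * n + 1).factorial ^ 2) := by
  have h : ∀ m : ℕ, (∏ i ∈ Icc 1 m, (2 * n + 2 * i + 1 : ℂ)) *
      ((2 * n + 1).factorial * (n + m).factorial * 2 ^ m) =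
      (2 * n + 2 * m + 1).factorial * n.factorial := by
    intro m
    induction m with
    | zero => simp
    | succ m ih =>
      rw [prod_Icc_succ_top (by omega), ← add_assoc,
        show 2 * n + 2 * (m + 1) + 1 = 2 * n + 2 * m + 1 + 1 + 1 by ring,
        Nat.factorial_succ (2 * n + 2 * m + 1 + 1), Nat.factorial_succ (2 * n + 2 * m + 1),
        Nat.factorial_succ (n + m)]
      push_cast
      linear_combination (2 * n + 2 * m + 2 : ℂ) * (2 * n + 2 * m + 3) * ih
  have hn := h n
  rw [eq_div_iff (by simp [Nat.factorial_ne_zero]), Nat.factorial_succ (4 * n + 1),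
    Nat.factorial_succ (2 * n)]
  rw [Nat.factorial_succ (2 * n), show 2 * n + 2 * n + 1 = 4 * n + 1 by ring, ← two_mul] at hn
  push_cast at hn ⊢
  linear_combination (4 * n + 2 : ℂ) * hn

end closedForms

section enumeration

variable {ρ : ℂ} (hρ : ρ ^ 2 = ρ - 1)
include hρ

lemma evenZ_ones_eq (n : ℕ) : evenZ ρ (List.replicate (2 * n) 1) =
    ∏ i ∈ Icc 1 n, ((6 * i - 2).factorial / (2 * n + 2 * i).factorial : ℂ) := by
  induction n with
  | zero => simp [evenZ, evenSum]
  | succ n ih =>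
    obtain ⟨K, hK, h1, -⟩ := evenZ_ones_relations hρ n
    rw [invRising, prod_rising_eq, hK, ih] at h1
    have h2 : (∏ i ∈ Icc 1 (n + 1), ((2 * (n + 1) + 2 * i).factorial : ℂ)) *
        (2 * n + 2).factorial = (∏ i ∈ Icc 1 n, ((2 * n + 2 * i).factorial : ℂ)) *
          ((4 * n + 2).factorial * (4 * n + 4).factorial) := by
      have h : ∀ m : ℕ, (∏ i ∈ Icc 1 m, ((2 * (n + 1) + 2 * i).factorial : ℂ)) *
          (2 * n + 2).factorial = (∏ i ∈ Icc 1 m, ((2 * n + 2 * i).factorial : ℂ)) *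
            (2 * n + 2 * m + 2).factorial := by
        intro m
        induction m with
        | zero => simp
        | succ m ih =>
          rw [prod_Icc_succ_top (by omega), prod_Icc_succ_top (by omega), mul_right_comm, ih]
          ring_nf
      rw [prod_Icc_succ_top (by omega), mul_right_comm, h n]
      ring_nf
    have h3 : ∏ i ∈ Icc 1 n, ((2 * n + 2 * i).factorial : ℂ) ≠ 0 :=
      prod_ne_zero_iff.2 fun i _ => Nat.cast_ne_zero.2 (Nat.factorial_ne_zero _)
    have h4 : ∏ i ∈ Icc 1 (n + 1), ((2 * (n + 1) + 2 * i).factorial : ℂ) ≠ 0 :=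
      prod_ne_zero_iff.2 fun i _ => Nat.cast_ne_zero.2 (Nat.factorial_ne_zero _)
    rw [prod_div_distrib] at h1 ⊢
    rw [prod_Icc_succ_top (f := fun i => ((6 * i - 2).factorial : ℂ)) (by omega),
      show 6 * (n + 1) - 2 = 6 * n + 4 by omega, eq_div_iff h4, show 2 * (n + 1) = 2 * n + 2 by ring]
    rw [show 2 * (n + 1) = 2 * n + 2 by ring] at h2 h4
    have f1 := Nat.cast_ne_zero (R := ℂ).2 (Nat.factorial_ne_zero (4 * n + 3))
    have f2 := Nat.cast_ne_zero (R := ℂ).2 (Nat.factorial_ne_zero (2 * n + 1))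
    have f3 := Nat.cast_ne_zero (R := ℂ).2 (Nat.factorial_ne_zero (6 * n + 4))
    have f4 := Nat.cast_ne_zero (R := ℂ).2 (Nat.factorial_ne_zero (4 * n + 2))
    have f5 : (n + 1 : ℂ) ≠ 0 := Nat.cast_add_one_ne_zero n
    have e3 : (3 : ℂ) ^ n ≠ 0 := by simp
    rw [Nat.factorial_succ (4 * n + 3), Nat.factorial_succ (2 * n + 1)] at h2
    push_cast at h2
    rw [show (9 : ℂ) ^ n = (3 ^ n) ^ 2 by rw [← pow_mul, mul_comm, pow_mul]; norm_num,
      pow_add 3 (4 * n), mul_comm 4 n, pow_mul 3 n 4, mul_comm n 4,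
      pow_add 3 (6 * n), mul_comm 6 n, pow_mul 3 n 6, mul_comm n 6] at h1
    generalize (3 : ℂ) ^ n = t at *
    generalize ∏ i ∈ Icc 1 n, ((2 * n + 2 * i).factorial : ℂ) = D at *
    generalize ∏ i ∈ Icc 1 (n + 1), ((2 * n + 2 + 2 * i).factorial : ℂ) = D' at *
    generalize ∏ i ∈ Icc 1 n, ((6 * i - 2).factorial : ℂ) = C at *
    generalize evenZ ρ (List.replicate (2 * n + 2) 1) = E at *
    generalize ((4 * n + 2).factorial : ℂ) = a at *
    generalize ((4 * n + 3).factorial : ℂ) = a' at *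
    generalize ((2 * n + 1).factorial : ℂ) = b at *
    generalize ((6 * n + 4).factorial : ℂ) = c at *
    clear ih
    have hD : D = D' * b / (2 * a * a') := by
      rw [eq_div_iff (by simp [*])]
      apply mul_left_cancel₀ f5
      linear_combination -h2 / 2
    rw [hD] at h1
    field_simp at h1
    linear_combination -h1

lemma evenZ_neg_one_eq (n : ℕ) : -(-3) ^ n * 4 ^ n * evenZ ρ (-1 :: List.replicate (2 * n + 1) 1) =
    2 ^ n / 2 * ((3 * n + 2).factorial / (2 * n + 1).factorial) *
      ∏ i ∈ Icc 1 n, ((6 * i - 2).factorial / (2 * n + 2 * i + 1).factorial : ℂ) := by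
  obtain ⟨K, hK, h1, h2⟩ := evenZ_ones_relations hρ n
  rw [invRising, prod_rising_eq, evenZ_ones_eq hρ] at h1
  rw [prod_odd_step_eq] at h2
  have h3 : ∏ i ∈ Icc 1 n, ((6 * i - 2).factorial / (2 * n + 2 * i).factorial : ℂ) =
      (∏ i ∈ Icc 1 n, (2 * n + 2 * i + 1 : ℂ)) *
      ∏ i ∈ Icc 1 n, ((6 * i - 2).factorial / (2 * n + 2 * i + 1).factorial : ℂ) := by
    rw [← prod_mul_distrib]
    refine prod_congr rfl fun i _ => ?_
    have := Nat.cast_ne_zero (R := ℂ).2 (Nat.factorial_ne_zero (2 * n + 2 * i))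
    have h' : (2 * n + 2 * i + 1 : ℂ) ≠ 0 := by exact_mod_cast Nat.succ_ne_zero (2 * n + 2 * i)
    rw [Nat.factorial_succ]
    push_cast
    generalize (2 * n + 2 * i + 1 : ℂ) = u at h' ⊢
    field_simp
  rw [h3, prod_Icc_two_mul_add_one] at h1
  clear h3 hK
  have f1 := Nat.cast_ne_zero (R := ℂ).2 (Nat.factorial_ne_zero (4 * n + 2))
  have f2 := Nat.cast_ne_zero (R := ℂ).2 (Nat.factorial_ne_zero (2 * n + 1))
  have f3 := Nat.cast_ne_zero (R := ℂ).2 (Nat.factorial_ne_zero (6 * n + 4))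
  have f4 := Nat.cast_ne_zero (R := ℂ).2 (Nat.factorial_ne_zero n)
  have f5 := Nat.cast_ne_zero (R := ℂ).2 (Nat.factorial_ne_zero (3 * n + 2))
  generalize evenZ ρ (-1 :: List.replicate (2 * n + 1) 1) = B at *
  generalize ∏ i ∈ Icc 1 n, ((6 * i - 2).factorial / (2 * n + 2 * i + 1).factorial : ℂ) = R at *
  generalize ((4 * n + 2).factorial : ℂ) = a at *
  generalize ((2 * n + 1).factorial : ℂ) = b at *
  generalize ((6 * n + 4).factorial : ℂ) = c at *
  generalize (n.factorial : ℂ) = d at *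
  generalize ((3 * n + 2).factorial : ℂ) = f at *
  have e2 : (2 : ℂ) ^ n ≠ 0 := by simp
  have e3 : (3 : ℂ) ^ n ≠ 0 := by simp
  have es' : ((-1 : ℂ) ^ n) ≠ 0 := by simp
  rw [show (9 : ℂ) ^ n = (3 ^ n) ^ 2 by rw [← pow_mul, mul_comm, pow_mul]; norm_num, pow_succ 2 n,
    pow_add 3 (6 * n), mul_comm 6 n, pow_mul 3 n 6] at h1
  rw [pow_add 2 (4 * n), mul_comm 4 n, pow_mul 2 n 4, pow_succ 2 (2 * n), pow_add 2 (2 * n),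
    mul_comm 2 n, pow_mul 2 n 2, pow_add 3 (3 * n), mul_comm 3 n, pow_mul 3 n 3,
    pow_succ (-1) n] at h2
  rw [show (4 : ℂ) ^ n = (2 ^ n) ^ 2 by rw [← pow_mul, mul_comm, pow_mul]; norm_num,
    show (-3 : ℂ) ^ n = (-1) ^ n * 3 ^ n by rw [← mul_pow]; norm_num]
  generalize (2 : ℂ) ^ n = w at *
  generalize (3 : ℂ) ^ n = t at *
  generalize (-1 : ℂ) ^ n = s at *
  have hK : K = t ^ 2 * 3 * (a * d / (w * 2 * b ^ 2) * R) * (b / a) * (c / (t ^ 6 * 3 ^ 4 * b)) := by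
    field_simp at h1 ⊢
    linear_combination -h1
  rw [hK] at h2
  have hB : B = 3 * (t ^ 2 * 3 * (a * d / (w * 2 * b ^ 2) * R) * (b / a) *
      (c / (t ^ 6 * 3 ^ 4 * b))) / (w ^ 4 * 2 ^ 3) * (w ^ 2 * 2 * (s * -1 *
      (c * d / (w ^ 2 * 2 ^ 2 * (t ^ 3 * 3 ^ 2) * b * f)))⁻¹) := by
    field_simp at h2 ⊢
    linear_combination h2
  rw [hB]
  field_simp

end enumeration

/-- The integer value of a line state. -/
def stateVal (b : Bool) : ℤ := if b then 1 else 0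

/-- The row `a`, entered in state `h`, only passes through the values `0` and `1` and is left with
value `1`. -/
def IsRowFrom {N : ℕ} (h : Bool) (a : Fin N → ℤ) : Prop :=
  (∀ k, stateVal h + ∑ j ∈ univ.filter (fun j => j ≤ k), a j = 0 ∨
    stateVal h + ∑ j ∈ univ.filter (fun j => j ≤ k), a j = 1) ∧ stateVal h + ∑ j, a j = 1

/-- Symmetric matrices all of whose rows are valid when entered in the states `v`, with `d` nonzero
diagonal entries. -/
def IsTriangle {N : ℕ} (d : ℕ) (v : Fin N → Bool) (A : Matrix (Fin N) (Fin N) ℤ) : Prop :=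
  A.IsSymm ∧ (∀ i, IsRowFrom (v i) (A i)) ∧ (univ.filter (fun i => A i i ≠ 0)).card = d

/-- The change of states from `v` to `w`. -/
def stateDiff {N : ℕ} (v w : Fin N → Bool) : Fin N → ℤ := fun j => stateVal (w j) - stateVal (v j)

lemma stateVal_injective : Function.Injective stateVal := by
  decide

lemma exists_stateVal_eq {x : ℤ} : (∃ b, stateVal b = x) ↔ x = 0 ∨ x = 1 := by
  simp [stateVal, eq_comm]

@[simp] lemma isRowFrom_zero {h : Bool} {a : Fin 0 → ℤ} : IsRowFrom h a ↔ h = true := by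
  cases h <;> simp [IsRowFrom, stateVal]

lemma isRowFrom_succ {N : ℕ} {h : Bool} {a : Fin (N + 1) → ℤ} :
    IsRowFrom h a ↔ ∃ h', stateVal h' = stateVal h + a 0 ∧ IsRowFrom h' fun j => a j.succ := by
  have h0 : ∑ j ∈ univ.filter (fun j => j ≤ (0 : Fin (N + 1))), a j = a 0 := by
    rw [sum_filter, Fin.sum_univ_succ]
    simp
  have hs : ∀ k : Fin N, ∑ j ∈ univ.filter (fun j => j ≤ k.succ), a j =
      a 0 + ∑ j ∈ univ.filter (fun j => j ≤ k), a j.succ := fun k => by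
    rw [sum_filter, Fin.sum_univ_succ, sum_filter]
    simp [Fin.succ_le_succ_iff]
  rw [IsRowFrom, Fin.forall_fin_succ, h0, ← exists_stateVal_eq, Fin.sum_univ_succ]
  simp only [hs, ← add_assoc]
  constructor
  · rintro ⟨⟨⟨b, hb⟩, h1⟩, h2⟩
    exact ⟨b, hb, by simpa only [IsRowFrom, hb] using ⟨h1, h2⟩⟩
  · rintro ⟨b, hb, h1⟩
    rw [IsRowFrom, hb] at h1
    exact ⟨⟨⟨b, hb⟩, h1.1⟩, h1.2⟩

/-- The symmetric matrix with first row given by the state changes, and remaining block `B`. -/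
def borderMatrix {N : ℕ} (v : Fin (N + 1) → Bool) (h : Bool) (w : Fin N → Bool)
    (B : Matrix (Fin N) (Fin N) ℤ) : Matrix (Fin (N + 1)) (Fin (N + 1)) ℤ :=
  Fin.cons (Fin.cons (stateVal h - stateVal (v 0)) (stateDiff (fun j => v j.succ) w))
    fun i => Fin.cons (stateDiff (fun j => v j.succ) w i) (B i)

section borderMatrix

variable {N : ℕ} (v : Fin (N + 1) → Bool) (h : Bool) (w : Fin N → Bool)
  (B : Matrix (Fin N) (Fin N) ℤ)

@[simp] lemma borderMatrix_zero_zero : borderMatrix v h w B 0 0 = stateVal h - stateVal (v 0) := rfl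

@[simp] lemma borderMatrix_zero_succ (j : Fin N) :
    borderMatrix v h w B 0 j.succ = stateVal (w j) - stateVal (v j.succ) := rfl

@[simp] lemma borderMatrix_succ_zero (j : Fin N) :
    borderMatrix v h w B j.succ 0 = stateVal (w j) - stateVal (v j.succ) := rfl

@[simp] lemma borderMatrix_succ_succ (i j : Fin N) : borderMatrix v h w B i.succ j.succ = B i j :=
  rfl

lemma card_diag_borderMatrix :
    (univ.filter (fun i => borderMatrix v h w B i i ≠ 0)).card =
      (univ.filter (fun i => B i i ≠ 0)).card + if h = v 0 then 0 else 1 := by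
  rw [card_filter, card_filter, Fin.sum_univ_succ, add_comm]
  simp only [borderMatrix_zero_zero, borderMatrix_succ_succ]
  congr 1
  by_cases hv : h = v 0 <;> simp [hv, sub_eq_zero, stateVal_injective.eq_iff]

lemma isTriangle_borderMatrix {d : ℕ} : IsTriangle d v (borderMatrix v h w B) ↔
    IsRowFrom h (stateDiff (fun j => v j.succ) w) ∧ B.IsSymm ∧ (∀ i, IsRowFrom (w i) (B i)) ∧
      (univ.filter (fun i => B i i ≠ 0)).card + (if h = v 0 then 0 else 1) = d := by
  rw [IsTriangle, card_diag_borderMatrix, Fin.forall_fin_succ, isRowFrom_succ]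
  simp only [isRowFrom_succ (N := N), borderMatrix_zero_zero, borderMatrix_succ_zero,
    add_sub_cancel, stateVal_injective.eq_iff, exists_eq_left]
  have : (borderMatrix v h w B).IsSymm ↔ B.IsSymm := by
    simp [Matrix.IsSymm.ext_iff, Fin.forall_fin_succ]
  rw [this]
  tauto

lemma exists_borderMatrix_eq {d : ℕ} {A : Matrix (Fin (N + 1)) (Fin (N + 1)) ℤ}
    (hA : IsTriangle d v A) : ∃ h w, A = borderMatrix v h w (A.submatrix Fin.succ Fin.succ) := by
  choose s hs _ using fun i => isRowFrom_succ.1 (hA.2.1 i)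
  refine ⟨s 0, fun i => s i.succ, ?_⟩
  ext i j
  refine Fin.cases ?_ (fun i => ?_) i <;> refine Fin.cases ?_ (fun j => ?_) j
  · simp [hs]
  · simp [hs, hA.1.apply]
  · simp [hs]
  · simp

lemma borderMatrix_injective : Function.Injective
    fun x : (Bool × (Fin N → Bool)) × Matrix (Fin N) (Fin N) ℤ =>
      borderMatrix v x.1.1 x.1.2 x.2 := by
  rintro ⟨⟨h, w⟩, B⟩ ⟨⟨h', w'⟩, B'⟩ e
  have e := fun i j => congrFun (congrFun e i) j
  refine Prod.ext (Prod.ext ?_ (funext fun j => ?_)) (Matrix.ext fun i j => ?_)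
  · simpa [stateVal_injective.eq_iff] using e 0 0
  · simpa [stateVal_injective.eq_iff] using e 0 j.succ
  · simpa using e i.succ j.succ

/-- Decomposition of a triangle into its first row and the rest. -/
noncomputable def triangleEquiv (d : ℕ) :
    (Σ x : Bool × (Fin N → Bool), {B : Matrix (Fin N) (Fin N) ℤ //
      IsRowFrom x.1 (stateDiff (fun j => v j.succ) x.2) ∧ B.IsSymm ∧
        (∀ i, IsRowFrom (x.2 i) (B i)) ∧
        (univ.filter (fun i => B i i ≠ 0)).card + (if x.1 = v 0 then 0 else 1) = d}) ≃
      {A // IsTriangle d v A} :=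
  (Equiv.subtypeProdEquivSigmaSubtype _).symm.trans <| Equiv.ofBijective
    (fun x => ⟨borderMatrix v x.1.1.1 x.1.1.2 x.1.2, (isTriangle_borderMatrix _ _ _ _).2 x.2⟩)
    ⟨fun x y hxy => Subtype.ext (borderMatrix_injective v (congrArg Subtype.val hxy)),
      fun A => by
        obtain ⟨h, w, e⟩ := exists_borderMatrix_eq v A.2
        exact ⟨⟨((h, w), _), (isTriangle_borderMatrix _ _ _ _).1 (e ▸ A.2)⟩, Subtype.ext e.symm⟩⟩

end borderMatrix

section counting

lemma finite_isTriangle {N : ℕ} (d : ℕ) (v : Fin N → Bool) : Finite {A // IsTriangle d v A} := by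
  induction N generalizing d with
  | zero => infer_instance
  | succ N ih =>
    have : ∀ x : Bool × (Fin N → Bool), Finite {B : Matrix (Fin N) (Fin N) ℤ //
        IsRowFrom x.1 (stateDiff (fun j => v j.succ) x.2) ∧ B.IsSymm ∧
          (∀ i, IsRowFrom (x.2 i) (B i)) ∧
          (univ.filter (fun i => B i i ≠ 0)).card + (if x.1 = v 0 then 0 else 1) = d} := fun x => by
      have := ih (d - if x.1 = v 0 then 0 else 1) x.2
      refine Finite.of_injective (fun B => (⟨B.1, B.2.2.1, B.2.2.2.1, ?_⟩ :
        {A // IsTriangle (d - if x.1 = v 0 then 0 else 1) x.2 A})) fun B B' h =>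
          Subtype.ext (congrArg (fun C => C.1) h)
      have := B.2.2.2.2
      omega
    exact Finite.of_equiv _ (triangleEquiv v d)

open Classical in
lemma natCard_and {α : Type*} (P : Prop) (q : α → Prop) :
    Nat.card {a // P ∧ q a} = if P then Nat.card {a // q a} else 0 := by
  split_ifs with h <;> simp [h]

open Classical in
lemma card_isTriangle {N : ℕ} (d : ℕ) (v : Fin (N + 1) → Bool) :
    Nat.card {A // IsTriangle d v A} = ∑ x : Bool × (Fin N → Bool),
      if IsRowFrom x.1 (stateDiff (fun j => v j.succ) x.2) then
        Nat.card {B : Matrix (Fin N) (Fin N) ℤ // B.IsSymm ∧ (∀ i, IsRowFrom (x.2 i) (B i)) ∧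
          (univ.filter (fun i => B i i ≠ 0)).card + (if x.1 = v 0 then 0 else 1) = d}
      else 0 := by
  have := finite_isTriangle d v
  have := Finite.of_equiv _ (triangleEquiv v d).symm
  have := fun x => Finite.of_injective _ (sigma_mk_injective (i := x) (β := fun x : Bool ×
    (Fin N → Bool) => {B : Matrix (Fin N) (Fin N) ℤ //
      IsRowFrom x.1 (stateDiff (fun j => v j.succ) x.2) ∧ B.IsSymm ∧
        (∀ i, IsRowFrom (x.2 i) (B i)) ∧
        (univ.filter (fun i => B i i ≠ 0)).card + (if x.1 = v 0 then 0 else 1) = d}))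
  rw [← Nat.card_congr (triangleEquiv v d), Nat.card_sigma]
  exact sum_congr rfl fun x _ => by convert natCard_and _ _

open Classical in
lemma card_isTriangle_zero {N : ℕ} (v : Fin (N + 1) → Bool) :
    Nat.card {A // IsTriangle 0 v A} = ∑ w : Fin N → Bool,
      if IsRowFrom (v 0) (stateDiff (fun j => v j.succ) w)
        then Nat.card {B // IsTriangle 0 w B} else 0 := by
  rw [card_isTriangle, Fintype.sum_prod_type, sum_eq_single (v 0)]
  · simp [IsTriangle]
  · intro b _ hb
    simp [hb]
  · simp

open Classical in
lemma card_isTriangle_one {N : ℕ} (v : Fin (N + 1) → Bool) :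
    Nat.card {A // IsTriangle 1 v A} =
      (∑ w : Fin N → Bool, if IsRowFrom (v 0) (stateDiff (fun j => v j.succ) w)
        then Nat.card {B // IsTriangle 1 w B} else 0) +
      ∑ w : Fin N → Bool, if IsRowFrom (!v 0) (stateDiff (fun j => v j.succ) w)
        then Nat.card {B // IsTriangle 0 w B} else 0 := by
  rw [card_isTriangle, Fintype.sum_prod_type, Fintype.sum_bool]
  cases v 0
  · rw [add_comm]
    simp [IsTriangle]
  · simp [IsTriangle]

variable {ρ : ℂ}

open Classical in
lemma rowSum_ones {N : ℕ} (h : Bool) (v : Fin N → Bool) (Ψ : List Bool → ℂ) :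
    rowSum ρ 1 (List.replicate N 1) h (List.ofFn v) Ψ =
      ∑ w : Fin N → Bool, if IsRowFrom h (stateDiff v w) then Ψ (List.ofFn w) else 0 := by
  have hA : weightA ρ 1 = 1 := by rw [weightA]; ring
  have hB : weightB ρ 1 = 1 := by rw [weightB]; ring
  induction N generalizing h Ψ with
  | zero => simp
  | succ N ih =>
    have hsum : ∀ F : (Fin (N + 1) → Bool) → ℂ, ∑ w, F w = ∑ b : Bool, ∑ w, F (Fin.cons b w) :=
      fun F => by
        rw [← Fintype.sum_prod_type' (f := fun b w => F (Fin.cons b w))]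
        exact ((Fin.consEquiv fun _ => Bool).sum_comp F).symm
    have hrow : ∀ b w, IsRowFrom h (stateDiff v (Fin.cons b w)) ↔ ∃ h', stateVal h' =
        stateVal h + (stateVal b - stateVal (v 0)) ∧
          IsRowFrom h' (stateDiff (fun j => v j.succ) w) := fun b w => by
      rw [isRowFrom_succ]; rfl
    rw [hsum, Fintype.sum_bool]
    simp only [hrow, List.ofFn_succ, List.replicate_succ, rowSum, mul_one, hA, hB, one_mul,
      Fin.cons_zero, Fin.cons_succ, ih]
    cases h <;> cases v 0 <;> simp [stateVal, add_comm]

lemma evenSum_ones {N : ℕ} (v : Fin N → Bool) :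
    evenSum ρ (List.replicate N 1) (List.ofFn v) = Nat.card {A // IsTriangle 0 v A} := by
  classical
  induction N with
  | zero =>
    simp [evenSum, IsTriangle, Matrix.IsSymm, Subsingleton.elim _ (0 : Matrix (Fin 0) (Fin 0) ℤ)]
  | succ N ih =>
    rw [List.ofFn_succ, List.replicate_succ, evenSum, rowSum_ones, card_isTriangle_zero]
    push_cast
    simp only [ih]

lemma oddSum_ones (hρ : ρ ≠ 1) {N : ℕ} (v : Fin N → Bool) :
    oddSum ρ (List.replicate N 1) (List.ofFn v) = Nat.card {A // IsTriangle 1 v A} := by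
  classical
  have hF : ∀ b, weightF ρ b 1 = 1 := fun b => by
    rw [weightF, mul_one, ite_self, mul_one, div_self (sub_ne_zero.2 hρ)]
  induction N with
  | zero => simp [oddSum, IsTriangle]
  | succ N ih =>
    rw [List.ofFn_succ, List.replicate_succ, oddSum, rowSum_ones, rowSum_ones, card_isTriangle_one]
    push_cast
    simp only [ih, evenSum_ones, hF, one_mul]

end counting

lemma isOSASModd_iff {N : ℕ} (A : Matrix (Fin N) (Fin N) ℤ) :
    IsOSASModd A ↔ IsTriangle 1 (fun _ => false) A := by
  have h0 : ∀ a : Fin N → ℤ, IsRowFrom false a ↔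
      (∀ k, ∑ j ∈ univ.filter (fun j => j ≤ k), a j = 0 ∨
        ∑ j ∈ univ.filter (fun j => j ≤ k), a j = 1) ∧ ∑ j, a j = 1 := fun a => by
    simp [IsRowFrom, stateVal]
  simp only [IsOSASModd, IsDSASM, IsTriangle, h0, forall_and]
  constructor
  · rintro ⟨⟨⟨-, h1, -, h2, -⟩, hs⟩, hd⟩
    exact ⟨hs, ⟨h1, h2⟩, hd⟩
  · rintro ⟨hs, ⟨h1, h2⟩, hd⟩
    refine ⟨⟨⟨fun i j => ?_, h1, ?_, h2, ?_⟩, hs⟩, hd⟩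
    · have hj := h1 i j
      have e : univ.filter (fun l => l ≤ j) = insert j (univ.filter (fun l => l < j)) := by
        ext l; simp [le_iff_eq_or_lt]
      rw [e, sum_insert (by simp)] at hj
      have hlt : ∑ l ∈ univ.filter (fun l => l < j), A i l = 0 ∨
          ∑ l ∈ univ.filter (fun l => l < j), A i l = 1 := by
        rcases (univ.filter (fun l => l < j)).eq_empty_or_nonempty with h | h
        · simp [h]
        · have e' : univ.filter (fun l => l < j) =
              univ.filter (fun l => l ≤ (univ.filter (fun l => l < j)).max' h) := by
            ext l
            simp only [mem_filter, mem_univ, true_and]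
            exact ⟨fun hl => le_max' _ _ (by simpa using hl), fun hl =>
              hl.trans_lt (by simp)⟩
          rw [e']
          exact h1 i _
      omega
    · intro j k
      simpa only [hs.apply] using h1 j k
    · intro j
      simpa only [hs.apply] using h2 j

/-- The number of OSASMs of order 2n+1 equals
2^{n-1} (3n+2)!/(2n+1)! · ∏_{i=1}^{n} (6i-2)!/(2n+2i+1)!. -/
theorem osasm_odd_count (n : ℕ) :
    (Nat.card {A : Matrix (Fin (2*n+1)) (Fin (2*n+1)) ℤ // IsOSASModd A} : ℚ) =
      (2 : ℚ) ^ ((n : ℤ) - 1) * ((3*n+2).factorial : ℚ) / ((2*n+1).factorial : ℚ) *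
        ∏ i ∈ Finset.Icc 1 n, ((6*i-2).factorial : ℚ) / ((2*n+2*i+1).factorial : ℚ) := by
  obtain ⟨ρ, hρ⟩ : ∃ ρ : ℂ, ρ ^ 2 = ρ - 1 := by
    refine ⟨(1 + Real.sqrt 3 * Complex.I) / 2, ?_⟩
    have h3 : (Real.sqrt 3 : ℂ) ^ 2 = 3 := by
      rw [← Complex.ofReal_pow, Real.sq_sqrt (by norm_num)]; norm_num
    linear_combination (Complex.I ^ 2 / 4) * h3 + 3 / 4 * Complex.I_sq
  have hcard : ∀ ρ' : ℂ, ρ' ≠ 1 → oddZ ρ' (List.replicate (2 * n + 1) 1) =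
      Nat.card {A : Matrix (Fin (2*n+1)) (Fin (2*n+1)) ℤ // IsOSASModd A} := fun ρ' h => by
    have := oddSum_ones h fun _ : Fin (2 * n + 1) => false
    rw [List.ofFn_const] at this
    rw [oddZ, List.length_replicate, this]
    simp only [isOSASModd_iff]
  have h1 : ρ ≠ 1 := by rintro rfl; norm_num at hρ
  have h2 : 1 - ρ ≠ 1 := by simpa using root_ne_zero hρ
  have key := oddZ_ones hρ n
  rw [hcard ρ h1, hcard _ h2] at key
  have hB := evenZ_neg_one_eq hρ n
  have hC : (Nat.card {A : Matrix (Fin (2*n+1)) (Fin (2*n+1)) ℤ // IsOSASModd A} : ℂ) =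
      2 ^ n / 2 * ((3 * n + 2).factorial / (2 * n + 1).factorial) *
      ∏ i ∈ Icc 1 n, ((6 * i - 2).factorial / (2 * n + 2 * i + 1).factorial : ℂ) := by
    rw [← hB]
    rw [pow_succ, pow_mul] at key
    norm_num at key
    linear_combination key / 2
  have hQ : (Nat.card {A : Matrix (Fin (2*n+1)) (Fin (2*n+1)) ℤ // IsOSASModd A} : ℚ) =
      2 ^ n / 2 * ((3 * n + 2).factorial / (2 * n + 1).factorial) *
      ∏ i ∈ Icc 1 n, ((6 * i - 2).factorial / (2 * n + 2 * i + 1).factorial : ℚ) := by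
    apply Rat.cast_injective (α := ℂ)
    push_cast
    exact hC
  rw [hQ, zpow_sub_one₀ (by norm_num), zpow_natCast]
  ring
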